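/- arXiv:1802.04726 — 3 statements merged into one kernel-verified Lean document; each statement's English description precedes it below -/
import Mathlib

section
/- Let $\Omega$ be a domain in $\mathbb{R}^n$ ($n \geq 2$) and let $\mathbb{H}$ be a smooth hypersurface in $\mathbb{R}^n$ (an $(n-1)$-dimensional $C^1$ submanifold) such that $\mathbb{H} \cap \Omega \neq \emptyset$. Let $u$ be an upper semicontinuous function and $v$ be a subharmonic function in $\Omega$. If $u \geq v$ almost everywhere on $\mathbb{H} \cap \Omega$ with respect to the surface measure on $\mathbb{H}$ (the $(n-1)$-dimensional Hausdorff measure restricted to $\mathbb{H}$), then $u \geq v$ everywhere on $\mathbb{H} \cap \Omega$. -/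
open MeasureTheory Metric Filter Set ENNReal Topology

noncomputable section

/-- Euclidean space `ℝⁿ`. -/
abbrev Eucl (n : ℕ) := EuclideanSpace ℝ (Fin n)

/-- The Laplacian of a real-valued function on `ℝⁿ`, as the sum of second partial
derivatives in the coordinate directions. -/
noncomputable def lap {n : ℕ} (f : Eucl n → ℝ) (x : Eucl n) : ℝ :=
  ∑ i : Fin n, fderiv ℝ (fun y => fderiv ℝ f y (EuclideanSpace.single i 1)) x
    (EuclideanSpace.single i 1)

/-- `f` is harmonic on a set `G`: it is `C²` there and its Laplacian vanishes. -/
def IsHarmonicOn {n : ℕ} (f : Eucl n → ℝ) (G : Set (Eucl n)) : Prop :=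
  ContDiffOn ℝ 2 f G ∧ ∀ x ∈ G, lap f x = 0

/-- `u : Ω → [-∞, ∞)` is subharmonic on `Ω`: it is upper semicontinuous, takes values
in `[-∞, ∞)`, is not identically `-∞`, and for every relatively compact open subset `G`
of `Ω` and every `φ` harmonic on `G` and continuous on `closure G`, `u ≤ φ` on `∂G`
implies `u ≤ φ` on `G`. -/
def IsSubharmonicOn {n : ℕ} (u : Eucl n → EReal) (Ω : Set (Eucl n)) : Prop :=
  UpperSemicontinuousOn u Ω ∧ (∀ x ∈ Ω, u x < ⊤) ∧ (∃ x ∈ Ω, u x ≠ ⊥) ∧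
  ∀ G : Set (Eucl n), IsOpen G → IsCompact (closure G) → closure G ⊆ Ω →
    ∀ φ : Eucl n → ℝ, IsHarmonicOn φ G → ContinuousOn φ (closure G) →
      (∀ x ∈ frontier G, u x ≤ (φ x : EReal)) → ∀ x ∈ G, u x ≤ (φ x : EReal)

/-- The positive part of an extended real number, as a value in `ℝ≥0∞`. -/
noncomputable def EReal.posPart (a : EReal) : ℝ≥0∞ :=
  if a = ⊤ then ⊤ else ENNReal.ofReal a.toReal

/-- The integral `∫_S u dμ` of an `EReal`-valued function, with values in `[-∞, +∞]`. -/
noncomputable def eintegral {n : ℕ} (μ : Measure (Eucl n)) (S : Set (Eucl n))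
    (u : Eucl n → EReal) : EReal :=
  ((∫⁻ x in S, (u x).posPart ∂μ : ℝ≥0∞) : EReal) -
    ((∫⁻ x in S, (-(u x)).posPart ∂μ : ℝ≥0∞) : EReal)

/-- The `μ`-average `(1/μ(S)) ∫_S u dμ` of an `EReal`-valued function over `S`. -/
noncomputable def eavg {n : ℕ} (μ : Measure (Eucl n)) (S : Set (Eucl n))
    (u : Eucl n → EReal) : EReal :=
  (((μ S)⁻¹ : ℝ≥0∞) : EReal) * eintegral μ S u


/-- `H` is a smooth (`C¹`) hypersurface in `ℝⁿ`: near each of its points it is the regular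
zero level set of a `C¹` function (an `(n-1)`-dimensional `C¹` submanifold). -/
def IsC1Hypersurface {n : ℕ} (H : Set (Eucl n)) : Prop :=
  ∀ x ∈ H, ∃ U : Set (Eucl n), IsOpen U ∧ x ∈ U ∧ ∃ f : Eucl n → ℝ,
    ContDiffOn ℝ 1 f U ∧ (∀ y ∈ U, fderiv ℝ f y ≠ 0) ∧ H ∩ U = {y ∈ U | f y = 0}

/-- The radial antiderivative of `t ↦ t^{-d}`. -/
def radK (d : ℕ) (R ρ : ℝ) : ℝ := ∫ t in ρ..R, (t ^ d)⁻¹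

lemma radK_intble (d : ℕ) {a b : ℝ} (ha : 0 < a) (hb : 0 < b) :
    IntervalIntegrable (fun t : ℝ => (t ^ d)⁻¹) volume a b := by
  apply ContinuousOn.intervalIntegrable
  intro x hx
  have hx0 : 0 < x := lt_of_lt_of_le (lt_min ha hb) hx.1
  have : x ^ d ≠ 0 := by positivity
  exact ((continuousAt_id.pow d).inv₀ this).continuousWithinAt

lemma radK_hasDerivAt (d : ℕ) {R ρ : ℝ} (hR : 0 < R) (hρ : 0 < ρ) :
    HasDerivAt (radK d R) (-(ρ ^ d)⁻¹) ρ := by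
  have h0 : ρ ^ d ≠ 0 := by positivity
  apply intervalIntegral.integral_hasDerivAt_left (radK_intble d hρ hR)
  · apply Measurable.stronglyMeasurable _ |>.stronglyMeasurableAtFilter
    fun_prop
  · exact (continuousAt_id.pow d).inv₀ h0

lemma norm_hasFDerivAt {n : ℕ} (a x : Eucl n) (hx : x ≠ a) :
    HasFDerivAt (fun y : Eucl n => ‖y - a‖) (‖x - a‖⁻¹ • innerSL ℝ (x - a)) x := by
  have h0 : ‖x - a‖ ≠ 0 := by simpa [sub_eq_zero] using hx
  have h1 : HasFDerivAt (fun y : Eucl n => ‖y - a‖ ^ 2) (2 • innerSL ℝ (x - a)) x := by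
    have := (hasStrictFDerivAt_norm_sq (x - a)).hasFDerivAt.comp x
      ((hasFDerivAt_id x).sub_const a)
    exact this.congr_fderiv (by ext; simp)
  have h2 := h1.sqrt (by positivity)
  have h3 : (fun y : Eucl n => √(‖y - a‖ ^ 2)) = fun y => ‖y - a‖ := by
    ext y; simp
  rw [h3] at h2
  refine h2.congr_fderiv ?_
  rw [Real.sqrt_sq (norm_nonneg _), ← Nat.cast_smul_eq_nsmul ℝ, smul_smul]
  congr 1
  push_cast
  field_simp

lemma radK_hasFDerivAt {n : ℕ} (d : ℕ) {R : ℝ} (hR : 0 < R) (a x : Eucl n) (hx : x ≠ a) :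
    HasFDerivAt (fun y : Eucl n => radK d R ‖y - a‖)
      ((-(‖x - a‖ ^ (d + 1))⁻¹) • innerSL ℝ (x - a)) x := by
  have h0 : 0 < ‖x - a‖ := by simpa [sub_eq_zero] using hx
  have := (radK_hasDerivAt d hR h0).comp_hasFDerivAt x (norm_hasFDerivAt a x hx)
  refine this.congr_fderiv ?_
  rw [smul_smul]
  congr 1
  field_simp
  ring

lemma radK_harmonic {d : ℕ} {R : ℝ} (hR : 0 < R) (a : Eucl (d + 1)) (G : Set (Eucl (d + 1)))
    (hG : IsOpen G) (ha : a ∉ G) :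
    IsHarmonicOn (fun y => radK d R ‖y - a‖) G := by
  have hne : ∀ x ∈ G, x ≠ a := fun x hx h => ha (h ▸ hx)
  constructor
  · have h2 : (2 : WithTop ℕ∞) = 1 + 1 := by norm_num
    rw [h2, contDiffOn_succ_iff_fderiv_of_isOpen hG]
    refine ⟨fun x hx => (radK_hasFDerivAt d hR a x (hne x hx)).differentiableAt.differentiableWithinAt,
      by simp, ?_⟩
    have : ContDiffOn ℝ 1 (fun x : Eucl (d + 1) =>
        (-(‖x - a‖ ^ (d + 1))⁻¹) • innerSL ℝ (x - a)) G := by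
      intro x hx
      have h0 : x - a ≠ 0 := sub_ne_zero.2 (hne x hx)
      have h1 : ContDiffAt ℝ 1 (fun x : Eucl (d + 1) => x - a) x := by fun_prop
      have hn : ContDiffAt ℝ 1 (fun x : Eucl (d + 1) => ‖x - a‖) x := h1.norm ℝ h0
      refine ContDiffAt.contDiffWithinAt ?_
      have hA : ContDiffAt ℝ 1 (fun x : Eucl (d + 1) => -(‖x - a‖ ^ (d + 1))⁻¹) x :=
        ((hn.pow (d + 1)).inv (by simpa using h0)).neg
      have hB : ContDiffAt ℝ 1 (fun x : Eucl (d + 1) => innerSL ℝ (x - a)) x :=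
        (innerSL ℝ (E := Eucl (d + 1))).contDiff.contDiffAt.comp x h1
      exact hA.smul hB
    exact this.congr fun x hx => (radK_hasFDerivAt d hR a x (hne x hx)).fderiv
  · intro x hx
    have hxa := hne x hx
    have h0 : 0 < ‖x - a‖ := by simpa [sub_eq_zero] using hxa
    have key : ∀ i : Fin (d + 1),
        fderiv ℝ (fun y => fderiv ℝ (fun y => radK d R ‖y - a‖) y (EuclideanSpace.single i 1)) x
          (EuclideanSpace.single i 1) =
        (d + 1) * (‖x - a‖ ^ (d + 3))⁻¹ * (x i - a i) ^ 2 - (‖x - a‖ ^ (d + 1))⁻¹ := by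
      intro i
      have e : (fun y => fderiv ℝ (fun y => radK d R ‖y - a‖) y (EuclideanSpace.single i 1))
          =ᶠ[𝓝 x] fun y => (-(‖y - a‖ ^ (d + 1))⁻¹) * (y i - a i) := by
        filter_upwards [hG.mem_nhds hx] with y hy
        rw [(radK_hasFDerivAt d hR a y (hne y hy)).fderiv]
        simp [EuclideanSpace.inner_single_right]
      rw [e.fderiv_eq]
      have hp : HasFDerivAt (fun y : Eucl (d + 1) => y i - a i)
          (EuclideanSpace.proj (𝕜 := ℝ) i : Eucl (d + 1) →L[ℝ] ℝ) x :=
        ((EuclideanSpace.proj (𝕜 := ℝ) i : Eucl (d + 1) →L[ℝ] ℝ).hasFDerivAt).sub_const (a i)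
      have hq : HasDerivAt (fun t : ℝ => -(t ^ (d + 1))⁻¹)
          ((d + 1) * (‖x - a‖ ^ (d + 2))⁻¹) ‖x - a‖ := by
        have := ((hasDerivAt_pow (d + 1) ‖x - a‖).inv (by positivity)).neg
        refine this.congr_deriv ?_
        push_cast
        field_simp
        ring
      have hq2 := hq.comp_hasFDerivAt x (norm_hasFDerivAt a x hxa)
      have hF : HasFDerivAt (fun y : Eucl (d + 1) => (-(‖y - a‖ ^ (d + 1))⁻¹) * (y i - a i)) _ x :=
        hq2.mul hp
      rw [hF.fderiv]
      simp [EuclideanSpace.inner_single_right]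
      field_simp
      ring
    unfold lap
    simp_rw [key]
    rw [Finset.sum_sub_distrib, ← Finset.mul_sum]
    have : ∑ i, (x i - a i) ^ 2 = ‖x - a‖ ^ 2 := by
      rw [EuclideanSpace.norm_sq_eq]; simp
    rw [this]
    simp
    field_simp
    ring

lemma IsHarmonicOn.diffAt {n : ℕ} {f : Eucl n → ℝ} {G : Set (Eucl n)} (hG : IsOpen G)
    (hf : IsHarmonicOn f G) {x : Eucl n} (hx : x ∈ G) (e : Eucl n) :
    DifferentiableAt ℝ (fun y => fderiv ℝ f y e) x := by
  have h2 : ContDiffAt ℝ 2 f x := hf.1.contDiffAt (hG.mem_nhds hx)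
  have h1 : ContDiffAt ℝ 1 (fderiv ℝ f) x := h2.fderiv_right (by norm_num)
  exact (h1.differentiableAt (by norm_num)).clm_apply (differentiableAt_const e)

lemma IsHarmonicOn.diffAt0 {n : ℕ} {f : Eucl n → ℝ} {G : Set (Eucl n)} (hG : IsOpen G)
    (hf : IsHarmonicOn f G) {x : Eucl n} (hx : x ∈ G) : DifferentiableAt ℝ f x :=
  (hf.1.contDiffAt (hG.mem_nhds hx)).differentiableAt (by norm_num)

lemma isHarmonicOn_const {n : ℕ} (c : ℝ) (G : Set (Eucl n)) :
    IsHarmonicOn (fun _ : Eucl n => c) G := by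
  refine ⟨contDiffOn_const, fun x _ => ?_⟩
  simp [lap]

lemma IsHarmonicOn.add {n : ℕ} {f g : Eucl n → ℝ} {G : Set (Eucl n)} (hG : IsOpen G)
    (hf : IsHarmonicOn f G) (hg : IsHarmonicOn g G) : IsHarmonicOn (fun x => f x + g x) G := by
  refine ⟨hf.1.add hg.1, fun x hx => ?_⟩
  have h := congrArg₂ (· + ·) (hf.2 x hx) (hg.2 x hx)
  simp only [add_zero] at h
  rw [← h]
  unfold lap
  rw [← Finset.sum_add_distrib]
  refine Finset.sum_congr rfl fun i _ => ?_
  have e : (fun y => fderiv ℝ (fun x => f x + g x) y (EuclideanSpace.single i 1))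
      =ᶠ[𝓝 x] fun y => fderiv ℝ f y (EuclideanSpace.single i 1) +
        fderiv ℝ g y (EuclideanSpace.single i 1) := by
    filter_upwards [hG.mem_nhds hx] with y hy
    rw [fderiv_fun_add (hf.diffAt0 hG hy) (hg.diffAt0 hG hy)]
    rfl
  rw [e.fderiv_eq, fderiv_fun_add (hf.diffAt hG hx _) (hg.diffAt hG hx _)]
  rfl

lemma IsHarmonicOn.const_mul {n : ℕ} {f : Eucl n → ℝ} {G : Set (Eucl n)} (hG : IsOpen G)
    (hf : IsHarmonicOn f G) (c : ℝ) : IsHarmonicOn (fun x => c * f x) G := by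
  refine ⟨contDiffOn_const.mul hf.1, fun x hx => ?_⟩
  have h := congrArg (c * ·) (hf.2 x hx)
  simp only [mul_zero] at h
  rw [← h]
  unfold lap
  rw [Finset.mul_sum]
  refine Finset.sum_congr rfl fun i _ => ?_
  have e : (fun y => fderiv ℝ (fun x => c * f x) y (EuclideanSpace.single i 1))
      =ᶠ[𝓝 x] fun y => c * fderiv ℝ f y (EuclideanSpace.single i 1) := by
    filter_upwards [hG.mem_nhds hx] with y hy
    rw [fderiv_const_mul (hf.diffAt0 hG hy)]
    rfl
  rw [e.fderiv_eq, fderiv_const_mul (hf.diffAt hG hx _)]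
  rfl

lemma IsHarmonicOn.sum {n : ℕ} {ι : Type*} (T : Finset ι) {f : ι → Eucl n → ℝ}
    {G : Set (Eucl n)} (hG : IsOpen G)
    (hf : ∀ i ∈ T, IsHarmonicOn (f i) G) : IsHarmonicOn (fun x => ∑ i ∈ T, f i x) G := by
  classical
  induction T using Finset.induction_on with
  | empty => simpa using isHarmonicOn_const 0 G
  | insert a s ha ih =>
    simp_rw [Finset.sum_insert ha]
    exact (hf a (by simp)).add hG (ih fun i hi => hf i (by simp [hi]))

/-- Elementary bounds on `radK`. -/
lemma radK_nonpos {d : ℕ} {R ρ : ℝ} (hR : 0 < R) (h : R ≤ ρ) : radK d R ρ ≤ 0 := by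
  unfold radK
  rw [intervalIntegral.integral_symm]
  have : 0 ≤ ∫ t in R..ρ, (t ^ d)⁻¹ := by
    apply intervalIntegral.integral_nonneg h
    intro t ht
    have : 0 < t := lt_of_lt_of_le hR ht.1
    positivity
  linarith

lemma radK_lower {d : ℕ} {R ρ : ℝ} (hρ : 0 < ρ) (h : ρ ≤ R) :
    (R - ρ) * (R ^ d)⁻¹ ≤ radK d R ρ := by
  unfold radK
  have hR : 0 < R := lt_of_lt_of_le hρ h
  have := intervalIntegral.integral_mono_on h (intervalIntegrable_const (c := (R ^ d)⁻¹))
    (radK_intble d hρ hR) (fun t ht => by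
      have : 0 < t := lt_of_lt_of_le hρ ht.1
      have := ht.2
      gcongr)
  simpa using this

lemma radK_anti {d : ℕ} {R ρ ρ' : ℝ} (hR : 0 < R) (hρ : 0 < ρ) (h : ρ ≤ ρ') :
    radK d R ρ' ≤ radK d R ρ := by
  have hρ' := lt_of_lt_of_le hρ h
  have : radK d R ρ = (∫ t in ρ..ρ', (t ^ d)⁻¹) + radK d R ρ' := by
    unfold radK
    rw [intervalIntegral.integral_add_adjacent_intervals (radK_intble d hρ hρ')
      (radK_intble d hρ' hR)]
  have h2 : 0 ≤ ∫ t in ρ..ρ', (t ^ d)⁻¹ := by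
    apply intervalIntegral.integral_nonneg h
    intro t ht
    have : 0 < t := lt_of_lt_of_le hρ ht.1
    positivity
  linarith

lemma radK_upper {d : ℕ} (hd : 1 ≤ d) {R ρ : ℝ} (hR : 0 < R) (hρ : 0 < ρ) :
    radK d R ρ ≤ 2 * √R * ρ ^ ((1 : ℝ) / 2 - d) := by
  rcases le_total R ρ with h | h
  · exact (radK_nonpos hR h).trans (by positivity)
  unfold radK
  have hd' : (1 : ℝ) ≤ d := by exact_mod_cast hd
  have hi : IntervalIntegrable (fun t : ℝ => ρ ^ ((1 : ℝ) / 2 - d) * t ^ (-(1 : ℝ) / 2))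
      volume ρ R := (intervalIntegral.intervalIntegrable_rpow' (by norm_num)).const_mul _
  have h1 := intervalIntegral.integral_mono_on h (radK_intble d hρ hR) hi (fun t ht => by
      have ht0 : 0 < t := lt_of_lt_of_le hρ ht.1
      have e : (t ^ d)⁻¹ = t ^ ((1 : ℝ) / 2 - d) * t ^ (-(1 : ℝ) / 2) := by
        rw [← Real.rpow_add ht0, ← Real.rpow_natCast, ← Real.rpow_neg ht0.le]
        congr 1; ring
      rw [e]
      gcongr ?_ * _
      exact Real.rpow_le_rpow_of_nonpos hρ ht.1 (by linarith))
  refine h1.trans ?_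
  rw [intervalIntegral.integral_const_mul, integral_rpow (by left; norm_num)]
  have e2 : (-(1 : ℝ) / 2 + 1) = 1 / 2 := by norm_num
  rw [e2, ← Real.sqrt_eq_rpow, ← Real.sqrt_eq_rpow, mul_comm]
  have := Real.sqrt_nonneg ρ
  have h3 : 0 ≤ ρ ^ ((1 : ℝ) / 2 - d) := by positivity
  gcongr
  linarith
section param
variable {F : Type*} [NormedAddCommGroup F] [NormedSpace ℝ F] [FiniteDimensional ℝ F]
  [MeasurableSpace F] [BorelSpace F]

lemma kernel_integral (μ : Measure F) [μ.IsAddHaarMeasure] [Nontrivial F] {ρ : ℝ} (hρ : 0 < ρ) :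
    IntegrableOn (fun s : F => ‖s‖ ^ ((1 : ℝ) / 2 - Module.finrank ℝ F)) (ball 0 ρ) μ ∧
    ∫ s in ball (0 : F) ρ, ‖s‖ ^ ((1 : ℝ) / 2 - Module.finrank ℝ F) ∂μ =
      Module.finrank ℝ F * (μ.real (ball 0 1) * (2 * √ρ)) := by
  set d := Module.finrank ℝ F with hd
  have hd1 : 1 ≤ d := Module.finrank_pos
  have e : ∀ y : ℝ, 0 < y → y ^ (d - 1) * y ^ ((1 : ℝ) / 2 - d) = y ^ (-(1 : ℝ) / 2) := by
    intro y hy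
    rw [← Real.rpow_natCast, ← Real.rpow_add hy]
    congr 1
    push_cast [hd1]
    ring
  have hIntg : IntegrableOn (fun y : ℝ => y ^ (-(1 : ℝ) / 2)) (Ioo 0 ρ) := by
    have := (intervalIntegral.intervalIntegrable_rpow' (a := 0) (b := ρ)
      (r := -(1 : ℝ) / 2) (by norm_num))
    rw [intervalIntegrable_iff_integrableOn_Ioo_of_le hρ.le] at this
    exact this
  constructor
  · rw [integrableOn_fun_norm_addHaar μ (f := fun y : ℝ => y ^ ((1 : ℝ) / 2 - d)), ← hd]
    refine hIntg.congr_fun (fun y hy => ?_) measurableSet_Ioo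
    simp only [smul_eq_mul]
    exact (e y hy.1).symm
  · have h1 : ∫ s in ball (0 : F) ρ, ‖s‖ ^ ((1 : ℝ) / 2 - d) ∂μ =
        ∫ s : F, (fun y : ℝ => (Iio ρ).indicator (fun y => y ^ ((1 : ℝ) / 2 - d)) y) ‖s‖ ∂μ := by
      rw [← integral_indicator measurableSet_ball]
      congr 1
      ext s
      simp [indicator]
    rw [h1, integral_fun_norm_addHaar, ← hd]
    have h2 : ∫ y in Ioi (0 : ℝ), y ^ (d - 1) •
        (Iio ρ).indicator (fun y => y ^ ((1 : ℝ) / 2 - d)) y =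
        ∫ y in Ioi (0 : ℝ), (Ioo 0 ρ).indicator (fun y => y ^ (-(1 : ℝ) / 2)) y := by
      refine setIntegral_congr_fun measurableSet_Ioi fun y (hy : 0 < y) => ?_
      have e' := e y hy
      rw [one_div] at e'
      by_cases hyr : y < ρ <;> simp [hyr, hy]
      exact e'
    rw [h2, setIntegral_indicator measurableSet_Ioo]
    have h3 : Ioi (0 : ℝ) ∩ Ioo 0 ρ = Ioo 0 ρ := by ext; simp
    rw [h3, ← integral_Ioc_eq_integral_Ioo, ← intervalIntegral.integral_of_le hρ.le,
      integral_rpow (by left; norm_num)]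
    have e2 : (-(1 : ℝ) / 2 + 1) = 1 / 2 := by norm_num
    rw [e2, ← Real.sqrt_eq_rpow, ← Real.sqrt_eq_rpow, Real.sqrt_zero]
    simp
    ring_nf
    tauto

lemma exists_net (S : Set F) {r ε : ℝ} (hS : S ⊆ ball 0 r) (hε : 0 < ε) :
    ∃ T : Finset F, (T : Set F) ⊆ S ∧ (∀ s ∈ T, ∀ t ∈ T, s ≠ t → ε < dist s t) ∧
      S ⊆ ⋃ t ∈ T, closedBall t ε := by
  lift ε to NNReal using hε.le
  have hε0 : ε ≠ 0 := by rintro rfl; simp at hε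
  have hS' : TotallyBounded S := (isCompact_closedBall (0 : F) r).totallyBounded.subset
    (hS.trans ball_subset_closedBall)
  have hp : packingNumber ε S ≠ ⊤ := by
    obtain ⟨N, -, hN, hc⟩ := exists_finite_isCover_of_totallyBounded (ε := ε / 2) (by simpa) hS'
    have h := packingNumber_two_mul_le_externalCoveringNumber (ε / 2) S
    rw [mul_div_cancel₀ _ (by norm_num)] at h
    exact ((h.trans hc.externalCoveringNumber_le_encard).trans_lt hN.encard_lt_top).ne
  obtain hfin : (maximalSeparatedSet ε S).Finite := by
    rw [← encard_ne_top_iff, encard_maximalSeparatedSet hp]; exact hp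
  refine ⟨hfin.toFinset, by simpa using maximalSeparatedSet_subset, ?_, ?_⟩
  · intro s hs t ht hst
    have := isSeparated_maximalSeparatedSet (by simpa using hs) (by simpa using ht) hst
    simp only [edist_nndist] at this
    exact_mod_cast this
  · have := isCover_iff_subset_iUnion_closedBall.1 (isCover_maximalSeparatedSet hp)
    simpa using this

lemma sum_bound (μ : Measure F) [μ.IsAddHaarMeasure] [Nontrivial F] {r ε Λ R : ℝ}
    (hε : 0 < ε) (hεr : ε ≤ r) (hΛ : 1 ≤ Λ) (hR : 0 < R)
    (T : Finset F) (hT : (T : Set F) ⊆ ball 0 r)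
    (hsep : ∀ s ∈ T, ∀ t ∈ T, s ≠ t → ε < dist s t) (t₀ : F) (ht₀ : t₀ ∈ T)
    (ρ : F → ℝ) (hρ : ∀ t ∈ T, ε ≤ ρ t) (hρ' : ∀ t ∈ T, ‖t - t₀‖ ≤ 2 * Λ * ρ t) :
    ∑ t ∈ T, ε ^ (Module.finrank ℝ F) * radK (Module.finrank ℝ F) R (ρ t) ≤
      2 ^ (Module.finrank ℝ F) * ((2 * √R) * (3 * Λ) ^ ((Module.finrank ℝ F : ℝ) - 1 / 2) *
        (Module.finrank ℝ F * (2 * √(3 * r)))) := by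
  obtain ⟨hI, hV⟩ := kernel_integral μ (F := F) (ρ := 3 * r) (by linarith)
  set d := Module.finrank ℝ F with hd
  have hd1 : 1 ≤ d := Module.finrank_pos
  have hd' : (1 : ℝ) ≤ d := by exact_mod_cast hd1
  set ω := μ.real (ball (0 : F) 1) with hω
  have hω0 : 0 < ω := by
    rw [hω, Measure.real]
    exact ENNReal.toReal_pos (measure_ball_pos μ 0 one_pos).ne' measure_ball_lt_top.ne
  let g : F → ℝ := fun s => (2 * √R) * ((3 * Λ) ^ ((d : ℝ) - 1 / 2) * ‖s - t₀‖ ^ ((1 : ℝ) / 2 - d))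
  have hg0 : ∀ s, 0 ≤ g s := fun s => by positivity
  have hpre : (fun s : F => s - t₀) ⁻¹' ball 0 (3 * r) = ball t₀ (3 * r) := by
    ext s; simp [dist_eq_norm]
  have hmp : MeasurePreserving (fun s : F => s - t₀) μ μ := measurePreserving_sub_right μ t₀
  have hme : MeasurableEmbedding (fun s : F => s - t₀) :=
    (Homeomorph.subRight t₀).measurableEmbedding
  have hgI : IntegrableOn g (ball t₀ (3 * r)) μ := by
    have := (hmp.integrableOn_comp_preimage hme).2 hI
    rw [hpre] at this
    exact (this.const_mul _).const_mul _
  have hgV : ∫ s in ball t₀ (3 * r), g s ∂μ =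
      (2 * √R) * ((3 * Λ) ^ ((d : ℝ) - 1 / 2) * (d * (ω * (2 * √(3 * r))))) := by
    simp only [g]
    rw [integral_const_mul, integral_const_mul, ← hV, ← hpre,
      hmp.setIntegral_preimage_emb hme (fun s => ‖s‖ ^ ((1 : ℝ) / 2 - d))]
  have hsub : ∀ t ∈ T, ball t (ε / 2) ⊆ ball t₀ (3 * r) := by
    intro t ht s hs
    have h1 := hT ht
    have h2 := hT ht₀
    simp only [mem_ball, dist_zero_right] at h1 h2 hs ⊢
    have h3 := dist_triangle s t t₀
    have h4 : dist t t₀ ≤ ‖t‖ + ‖t₀‖ := by rw [dist_eq_norm]; exact norm_sub_le _ _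
    linarith
  have hdisj : Set.Pairwise (T : Set F) (Function.onFun Disjoint fun t => ball t (ε / 2)) := by
    intro s hs t ht hst
    have := hsep s hs t ht hst
    exact ball_disjoint_ball (by linarith)
  have hterm : ∀ t ∈ T, ω * (ε / 2) ^ d * radK d R (ρ t) ≤ ∫ s in ball t (ε / 2), g s ∂μ := by
    intro t ht
    have hm : μ.real (ball t (ε / 2)) = (ε / 2) ^ d * ω := by
      rw [Measure.real, Measure.addHaar_ball μ t (by positivity), ENNReal.toReal_mul,
        ENNReal.toReal_ofReal (by positivity)]
      rfl
    have hc : ∫ s in ball t (ε / 2), radK d R (ρ t) ∂μ = ω * (ε / 2) ^ d * radK d R (ρ t) := by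
      rw [setIntegral_const, hm, smul_eq_mul]; ring
    rw [← hc]
    apply integral_mono_ae
    · exact integrableOn_const measure_ball_lt_top.ne
    · exact hgI.mono_set (hsub t ht)
    · have hne : ∀ᵐ s ∂μ, s ≠ t₀ := by
        rw [ae_iff]; simp
      filter_upwards [ae_restrict_mem measurableSet_ball, ae_restrict_of_ae hne] with s hs hs0
      have hρ0 : 0 < ρ t := hε.trans_le (hρ t ht)
      have hs1 : 0 < ‖s - t₀‖ := by simpa [sub_eq_zero] using hs0
      have hle : ‖s - t₀‖ / (3 * Λ) ≤ ρ t := by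
        rw [div_le_iff₀ (by positivity)]
        have h3 := dist_triangle s t t₀
        rw [dist_eq_norm s t₀, dist_eq_norm t t₀] at h3
        have h4 := hρ' t ht
        have h5 := hρ t ht
        rw [mem_ball] at hs
        nlinarith
      refine (radK_upper hd1 hR hρ0).trans ?_
      simp only [g]
      have h6 : (ρ t) ^ ((1 : ℝ) / 2 - d) ≤ (‖s - t₀‖ / (3 * Λ)) ^ ((1 : ℝ) / 2 - d) :=
        Real.rpow_le_rpow_of_nonpos (by positivity) hle (by linarith)
      have h7 : (‖s - t₀‖ / (3 * Λ)) ^ ((1 : ℝ) / 2 - d) =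
          (3 * Λ) ^ ((d : ℝ) - 1 / 2) * ‖s - t₀‖ ^ ((1 : ℝ) / 2 - d) := by
        rw [Real.div_rpow hs1.le (by positivity), div_eq_mul_inv, ← Real.rpow_neg (by positivity),
          mul_comm]
        congr 2; ring
      rw [h7] at h6
      gcongr
  have hsum : ∑ t ∈ T, ω * (ε / 2) ^ d * radK d R (ρ t) ≤ ∫ s in ball t₀ (3 * r), g s ∂μ := by
    refine (Finset.sum_le_sum hterm).trans ?_
    rw [← integral_biUnion_finset T (fun _ _ => measurableSet_ball) hdisj
      (fun t ht => hgI.mono_set (hsub t ht))]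
    apply setIntegral_mono_set hgI (ae_of_all _ hg0)
    exact (iUnion₂_subset hsub).eventuallyLE
  rw [hgV, ← Finset.mul_sum] at hsum
  rw [← Finset.mul_sum]
  rw [div_pow] at hsum
  have h2d : (0 : ℝ) < 2 ^ d := by positivity
  have : ω * (ε ^ d * ∑ t ∈ T, radK d R (ρ t)) ≤
      ω * (2 ^ d * ((2 * √R) * (3 * Λ) ^ ((d : ℝ) - 1 / 2) * (d * (2 * √(3 * r))))) := by
    calc _ = 2 ^ d * (ω * (ε ^ d / 2 ^ d) * ∑ t ∈ T, radK d R (ρ t)) := by field_simp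
      _ ≤ 2 ^ d * ((2 * √R) * ((3 * Λ) ^ ((d : ℝ) - 1 / 2) * (d * (ω * (2 * √(3 * r)))))) := by
        gcongr
      _ = _ := by ring
  exact le_of_mul_le_mul_left this hω0

lemma card_bound (μ : Measure F) [μ.IsAddHaarMeasure] [Nontrivial F] {r ε : ℝ} (hr : 0 < r)
    (hε : 0 < ε) (S : Set F) (hS : μ (ball 0 r) / 2 ≤ μ S) (T : Finset F)
    (hT : S ⊆ ⋃ t ∈ T, closedBall t ε) :
    r ^ (Module.finrank ℝ F) / 2 ≤ T.card * ε ^ (Module.finrank ℝ F) := by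
  set d := Module.finrank ℝ F with hd
  have h1 : μ S ≤ ∑ t ∈ T, μ (closedBall t ε) :=
    (measure_mono hT).trans (measure_biUnion_finset_le T _)
  have h2 : ∀ t : F, μ (closedBall t ε) = ENNReal.ofReal (ε ^ d) * μ (ball 0 1) :=
    fun t => Measure.addHaar_closedBall μ t hε.le
  simp_rw [h2] at h1
  rw [Finset.sum_const, nsmul_eq_mul] at h1
  have h3 := hS.trans h1
  rw [Measure.addHaar_ball μ 0 hr.le, ← hd] at h3
  have hω : 0 < (μ (ball (0 : F) 1)).toReal :=
    ENNReal.toReal_pos (measure_ball_pos μ 0 one_pos).ne' measure_ball_lt_top.ne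
  have h4 := ENNReal.toReal_mono (by
    refine ENNReal.mul_ne_top (by simp) (ENNReal.mul_ne_top (by simp) measure_ball_lt_top.ne)) h3
  rw [ENNReal.toReal_div, ENNReal.toReal_mul, ENNReal.toReal_mul, ENNReal.toReal_mul,
    ENNReal.toReal_ofReal (by positivity), ENNReal.toReal_ofReal (by positivity)] at h4
  simp at h4
  refine le_of_mul_le_mul_right ?_ hω
  calc _ = r ^ d * (μ (ball (0 : F) 1)).toReal / 2 := by ring
    _ ≤ _ := h4
    _ = _ := by ring

end param
section param2
variable {F : Type*} [NormedAddCommGroup F] [NormedSpace ℝ F] [FiniteDimensional ℝ F]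
  [MeasurableSpace F] [BorelSpace F]

lemma exists_half (μ : Measure F) [μ.IsAddHaarMeasure] {n : ℕ} {r : ℝ} (hr : 0 < r)
    (γ : F → Eucl n) (O : Set (Eucl n)) (hO : IsOpen O)
    (hnull : μ {s ∈ ball (0 : F) r | γ s ∉ O} = 0) :
    ∃ ε : ℝ, 0 < ε ∧ ε ≤ r ∧
      μ (ball 0 r) / 2 ≤ μ {s ∈ ball (0 : F) r | closedBall (γ s) ε ⊆ O} := by
  let S : ℕ → Set F := fun k => {s ∈ ball (0 : F) r | closedBall (γ s) (r / (k + 1)) ⊆ O}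
  have hmono : Monotone S := by
    intro k l hkl s hs
    refine ⟨hs.1, (closedBall_subset_closedBall ?_).trans hs.2⟩
    have : (k : ℝ) ≤ l := by exact_mod_cast hkl
    gcongr
  have hcov : ball (0 : F) r ⊆ {s ∈ ball (0 : F) r | γ s ∉ O} ∪ ⋃ k, S k := by
    intro s hs
    by_cases h : γ s ∈ O
    · right
      obtain ⟨η, hη, hη2⟩ := Metric.isOpen_iff.1 hO _ h
      obtain ⟨k, hk⟩ := exists_nat_gt (r / η)
      refine mem_iUnion.2 ⟨k, hs, (closedBall_subset_ball ?_).trans hη2⟩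
      rw [div_lt_iff₀ hη] at hk
      rw [div_lt_iff₀ (by positivity)]
      nlinarith
    · exact Or.inl ⟨hs, h⟩
  have h1 : μ (ball 0 r) ≤ μ (⋃ k, S k) := by
    refine (measure_mono hcov).trans ((measure_union_le _ _).trans ?_)
    rw [hnull, zero_add]
  rw [hmono.measure_iUnion] at h1
  have h2 : μ (ball (0 : F) r) / 2 < μ (ball (0 : F) r) :=
    ENNReal.half_lt_self (measure_ball_pos μ 0 hr).ne' measure_ball_lt_top.ne
  obtain ⟨k, hk⟩ := lt_iSup_iff.1 (h2.trans_le h1)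
  refine ⟨r / (k + 1), by positivity, ?_, hk.le⟩
  rw [div_le_iff₀ (by positivity)]
  have : (0 : ℝ) ≤ k := by positivity
  nlinarith

lemma barrier (μ : Measure F) [μ.IsAddHaarMeasure] [Nontrivial F] {d : ℕ}
    (hd : Module.finrank ℝ F = d) {L Λ : ℝ} (hL : 1 ≤ L) (hΛ : 1 ≤ Λ) :
    ∃ δ : ℝ, 0 < δ ∧ ∀ r : ℝ, 0 < r → ∀ (x₀ : Eucl (d + 1)) (γ : F → Eucl (d + 1))
      (O : Set (Eucl (d + 1))), IsOpen O → x₀ ∉ O →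
      μ {s ∈ ball (0 : F) r | γ s ∉ O} = 0 →
      (∀ s ∈ ball (0 : F) r, ‖γ s - x₀‖ ≤ L * r) →
      (∀ s ∈ ball (0 : F) r, ∀ t ∈ ball (0 : F) r, ‖s - t‖ ≤ Λ * ‖γ s - γ t‖) →
      ∃ (G : Set (Eucl (d + 1))) (q : Eucl (d + 1) → ℝ), IsOpen G ∧ x₀ ∈ G ∧
        G ⊆ ball x₀ (3 * L * r) ∧ IsHarmonicOn q G ∧ ContinuousOn q (closure G) ∧
        (∀ y ∈ frontier G, q y ≤ 1) ∧ (∀ y ∈ frontier G, y ∉ O → q y ≤ 0) ∧ δ ≤ q x₀ := by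
  have hd1 : 1 ≤ d := hd ▸ Module.finrank_pos
  have hd0 : (0 : ℝ) < d := by exact_mod_cast hd1
  set C : ℝ := 2 ^ d * (4 * (3 * Λ) ^ ((d : ℝ) - 1 / 2) * d * √(6 * L)) with hC
  have hC0 : 0 < C := by positivity
  refine ⟨C⁻¹ * (L / (2 * (2 * L) ^ d)), by positivity, ?_⟩
  intro r hr x₀ γ O hO hx₀ hnull hγ1 hγ2
  obtain ⟨ε, hε, hεr, hhalf⟩ := exists_half μ hr γ O hO hnull
  obtain ⟨T, hTS, hsep, hcov⟩ := exists_net {s ∈ ball (0 : F) r | closedBall (γ s) ε ⊆ O}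
    (r := r) (fun s hs => hs.1) hε
  have hcard := card_bound μ hr hε _ hhalf T hcov
  have hTb : (T : Set F) ⊆ ball 0 r := fun s hs => (hTS hs).1
  rw [hd] at hcard
  have hTne : T.Nonempty := by
    rw [Finset.nonempty_iff_ne_empty]
    rintro rfl
    simp at hcard
    have : 0 < r ^ d := by positivity
    linarith
  set R : ℝ := 2 * L * r with hRdef
  have hR : 0 < R := by positivity
  have hCr : 2 ^ d * ((2 * √R) * (3 * Λ) ^ ((d : ℝ) - 1 / 2) * (d * (2 * √(3 * r)))) = C * r := by
    have : √R * √(3 * r) = √(6 * L) * r := by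
      rw [← Real.sqrt_mul hR.le, hRdef]
      have e : 2 * L * r * (3 * r) = (6 * L) * r ^ 2 := by ring
      rw [e, Real.sqrt_mul (by positivity), Real.sqrt_sq hr.le]
    calc _ = 2 ^ d * (4 * (3 * Λ) ^ ((d : ℝ) - 1 / 2) * d * (√R * √(3 * r))) := by ring
      _ = _ := by rw [this, hC]; ring
  set G : Set (Eucl (d + 1)) := ball x₀ (3 * L * r) ∩ ⋂ t ∈ T, (closedBall (γ t) ε)ᶜ with hG
  have hGo : IsOpen G := by
    refine isOpen_ball.inter (isOpen_biInter_finset fun t _ => isClosed_closedBall.isOpen_compl)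
  have hGcl : closure G ⊆ ⋂ t ∈ T, (ball (γ t) ε)ᶜ := by
    refine closure_minimal ?_ (isClosed_biInter fun t _ => isOpen_ball.isClosed_compl)
    refine inter_subset_right.trans (iInter₂_mono fun t _ => ?_)
    exact compl_subset_compl.2 ball_subset_closedBall
  have hfar : ∀ y ∈ closure G, ∀ t ∈ T, ε ≤ ‖y - γ t‖ := by
    intro y hy t ht
    have := mem_iInter₂.1 (hGcl hy) t ht
    simpa [dist_eq_norm] using this
  have hγT : ∀ t ∈ T, ‖γ t - x₀‖ ≤ L * r := fun t ht => hγ1 t (hTb ht)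
  refine ⟨G, fun y => (C * r)⁻¹ * ∑ t ∈ T, ε ^ d * radK d R ‖y - γ t‖, hGo, ?_, inter_subset_left,
    ?_, ?_, ?_, ?_, ?_⟩
  · refine ⟨mem_ball_self (by positivity), mem_iInter₂.2 fun t ht hx => hx₀ ((hTS ht).2 hx)⟩
  · refine IsHarmonicOn.const_mul hGo (IsHarmonicOn.sum T hGo fun t ht => ?_) _
    refine IsHarmonicOn.const_mul hGo (radK_harmonic hR _ G hGo fun h => ?_) _
    exact mem_iInter₂.1 h.2 t ht (mem_closedBall_self hε.le)
  · refine continuousOn_const.mul (continuousOn_finsetSum _ fun t ht => continuousOn_const.mul ?_)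
    intro y hy
    have h1 := hfar y hy t ht
    have hne : y ≠ γ t := by
      rintro rfl
      simp at h1
      linarith
    exact (radK_hasFDerivAt d hR (γ t) y hne).continuousAt.continuousWithinAt
  · intro y hy
    have hyc := hy.1
    obtain ⟨t₀, ht₀, hmin⟩ := T.exists_min_image (fun t => ‖y - γ t‖) hTne
    have := sum_bound μ hε hεr hΛ hR T hTb hsep t₀ ht₀ (fun t => ‖y - γ t‖) (hfar y hyc) (by
      intro t ht
      have h1 := hγ2 t (hTb ht) t₀ (hTb ht₀)
      have h2 : ‖γ t - γ t₀‖ ≤ ‖y - γ t‖ + ‖y - γ t₀‖ := by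
        have := norm_sub_le (y - γ t₀) (y - γ t)
        have e : γ t - γ t₀ = y - γ t₀ - (y - γ t) := by abel
        rw [e]
        linarith
      have h3 := hmin t ht
      have h4 : Λ * ‖γ t - γ t₀‖ ≤ Λ * (2 * ‖y - γ t‖) := by gcongr; linarith
      linarith)
    rw [hd, hCr] at this
    rw [inv_mul_le_iff₀ (by positivity), mul_one]
    exact this
  · intro y hy hyO
    have hyG : y ∉ G := by
      rw [hGo.frontier_eq] at hy
      exact hy.2
    have hyb : y ∉ ball x₀ (3 * L * r) := by
      intro hb
      refine hyG ⟨hb, mem_iInter₂.2 fun t ht hx => hyO ((hTS ht).2 hx)⟩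
    rw [mem_ball, dist_eq_norm, not_lt] at hyb
    refine mul_nonpos_of_nonneg_of_nonpos (by positivity) (Finset.sum_nonpos fun t ht => ?_)
    refine mul_nonpos_of_nonneg_of_nonpos (by positivity) (radK_nonpos hR ?_)
    have h1 := hγT t ht
    have h2 : ‖y - x₀‖ ≤ ‖y - γ t‖ + ‖γ t - x₀‖ := norm_sub_le_norm_sub_add_norm_sub _ _ _
    rw [hRdef]
    linarith
  · have hlow : ∀ t ∈ T, ε ^ d * ((L * r) * (R ^ d)⁻¹) ≤ ε ^ d * radK d R ‖x₀ - γ t‖ := by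
      intro t ht
      gcongr
      have hx : x₀ ≠ γ t := by
        intro h
        exact hx₀ (h ▸ (hTS ht).2 (mem_closedBall_self hε.le))
      have hpos : 0 < ‖x₀ - γ t‖ := by simpa [sub_eq_zero] using hx
      have h1 := hγT t ht
      rw [norm_sub_rev] at h1
      have hRL : R - L * r = L * r := by rw [hRdef]; ring
      calc L * r * (R ^ d)⁻¹ = (R - L * r) * (R ^ d)⁻¹ := by rw [hRL]
        _ ≤ radK d R (L * r) := radK_lower (by positivity) (by
            have : 0 < L * r := by positivity
            linarith)
        _ ≤ _ := radK_anti hR hpos h1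
    have h2 := Finset.sum_le_sum hlow
    rw [Finset.sum_const, nsmul_eq_mul, ← mul_assoc] at h2
    have h3 : r ^ d / 2 * ((L * r) * (R ^ d)⁻¹) ≤ T.card * ε ^ d * ((L * r) * (R ^ d)⁻¹) := by
      gcongr
    have h4 := h3.trans h2
    have h5 : r ^ d / 2 * ((L * r) * (R ^ d)⁻¹) = r * (L / (2 * (2 * L) ^ d)) := by
      rw [hRdef, mul_pow (2 * L) r]
      field_simp
    rw [h5] at h4
    calc C⁻¹ * (L / (2 * (2 * L) ^ d)) = (C * r)⁻¹ * (r * (L / (2 * (2 * L) ^ d))) := by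
          field_simp
      _ ≤ _ := mul_le_mul_of_nonneg_left h4 (by positivity)

end param2
lemma exists_chart {n : ℕ} (f : Eucl n → ℝ) (f' : Eucl n →L[ℝ] ℝ) (x₀ : Eucl n)
    (hf : HasStrictFDerivAt f f' x₀) (hf' : f' ≠ 0) (W : Set (Eucl n)) (hW : W ∈ 𝓝 x₀) :
    ∃ (γ : f'.ker → Eucl n) (η : ℝ), 0 < η ∧
      (∀ s ∈ ball (0 : f'.ker) η, γ s ∈ W ∧ f (γ s) = f x₀ ∧ ‖γ s - x₀‖ ≤ 2 * ‖s‖) ∧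
      ∀ s ∈ ball (0 : f'.ker) η, ∀ t ∈ ball (0 : f'.ker) η, ‖s - t‖ ≤ 2 * ‖γ s - γ t‖ := by
  have hr : f'.range = ⊤ := by
    apply LinearMap.range_eq_top.2
    apply LinearMap.surjective
    intro h
    apply hf'
    ext x
    exact congrArg (fun g : Eucl n →ₗ[ℝ] ℝ => g x) h
  set γ : f'.ker → Eucl n := hf.implicitFunction f f' hr (f x₀) with hγ
  have hg : HasStrictFDerivAt γ f'.ker.subtypeL 0 := hf.to_implicitFunction hr
  have hγ0 : γ 0 = x₀ := hf.implicitFunction_apply_image hr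
  have h1 : ∀ᶠ s in 𝓝 (0 : f'.ker), γ s ∈ W := by
    apply hg.hasFDerivAt.continuousAt
    rw [hγ0]; exact hW
  have h2 : ∀ᶠ s in 𝓝 (0 : f'.ker), f (γ s) = f x₀ := by
    have h := hf.map_implicitFunction_eq hr
    have hc : Tendsto (fun s : f'.ker => (f x₀, s)) (𝓝 0) (𝓝 (f x₀, 0)) :=
      (Continuous.prodMk_right (f x₀)).tendsto 0
    exact hc.eventually h
  have h3 : ∀ᶠ p in 𝓝 ((0 : f'.ker), (0 : f'.ker)),
      ‖γ p.1 - γ p.2 - f'.ker.subtypeL (p.1 - p.2)‖ ≤ (1 / 2) * ‖p.1 - p.2‖ :=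
    hg.isLittleO.def (by norm_num)
  obtain ⟨η1, hη1, H1⟩ := Metric.eventually_nhds_iff_ball.1 (h1.and h2)
  rw [nhds_prod_eq] at h3
  obtain ⟨A, hA, B, hB, H2⟩ := Filter.eventually_prod_iff.1 h3
  obtain ⟨η2, hη2, H3⟩ := Metric.eventually_nhds_iff_ball.1 (hA.and hB)
  have key : ∀ s ∈ ball (0 : f'.ker) η2, ∀ t ∈ ball (0 : f'.ker) η2,
      ‖γ s - γ t - ((s - t : f'.ker) : Eucl n)‖ ≤ (1 / 2) * ‖s - t‖ :=
    fun s hs t ht => H2 (H3 s hs).1 (H3 t ht).2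
  refine ⟨γ, min η1 η2, lt_min hη1 hη2, ?_, ?_⟩
  · intro s hs
    have hs1 : s ∈ ball (0 : f'.ker) η1 := ball_subset_ball (min_le_left _ _) hs
    have hs2 : s ∈ ball (0 : f'.ker) η2 := ball_subset_ball (min_le_right _ _) hs
    refine ⟨(H1 s hs1).1, (H1 s hs1).2, ?_⟩
    have h := key s hs2 0 (mem_ball_self hη2)
    rw [hγ0, sub_zero] at h
    have h4 := norm_le_norm_sub_add (γ s - x₀) (s : Eucl n)
    have h5 : ‖(s : Eucl n)‖ = ‖s‖ := rfl
    have := norm_nonneg s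
    linarith
  · intro s hs t ht
    have h := key s (ball_subset_ball (min_le_right _ _) hs) t
      (ball_subset_ball (min_le_right _ _) ht)
    have h4 := norm_le_norm_sub_add ((s - t : f'.ker) : Eucl n) (γ s - γ t)
    rw [norm_sub_rev] at h4
    have h5 : ‖((s - t : f'.ker) : Eucl n)‖ = ‖s - t‖ := rfl
    linarith

lemma null_param {n : ℕ} {F : Type*} [NormedAddCommGroup F] [MeasurableSpace F] [BorelSpace F]
    {d : ℝ} (hd : 0 ≤ d) (γ : F → Eucl n) (D : Set F)
    (h : ∀ s ∈ D, ∀ t ∈ D, ‖s - t‖ ≤ 2 * ‖γ s - γ t‖) (B : Set (Eucl n)) (hB : μH[d] B = 0) :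
    μH[d] {s ∈ D | γ s ∈ B} = 0 := by
  have hinj : InjOn γ D := by
    intro s hs t ht hst
    have := h s hs t ht
    rw [hst, sub_self, norm_zero, mul_zero] at this
    exact sub_eq_zero.1 (norm_le_zero_iff.1 this)
  set A := {s ∈ D | γ s ∈ B} with hA
  have hl : LipschitzOnWith 2 (Function.invFunOn γ D) (γ '' A) := by
    refine LipschitzOnWith.of_dist_le_mul ?_
    rintro _ ⟨s, hs, rfl⟩ _ ⟨t, ht, rfl⟩
    rw [hinj.leftInvOn_invFunOn hs.1, hinj.leftInvOn_invFunOn ht.1, dist_eq_norm, dist_eq_norm]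
    exact h s hs.1 t ht.1
  have himg : Function.invFunOn γ D '' (γ '' A) = A := by
    ext s
    constructor
    · rintro ⟨_, ⟨t, ht, rfl⟩, rfl⟩
      rw [hinj.leftInvOn_invFunOn ht.1]; exact ht
    · intro hs
      exact ⟨γ s, ⟨s, hs, rfl⟩, hinj.leftInvOn_invFunOn hs.1⟩
  have h0 : μH[d] (γ '' A) = 0 := by
    refine measure_mono_null ?_ hB
    rintro _ ⟨s, hs, rfl⟩
    exact hs.2
  have := hl.hausdorffMeasure_image_le hd
  rw [himg, h0, mul_zero] at this
  exact nonpos_iff_eq_zero.1 this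

/-- **Corollary 4.2.** Let `Ω ⊆ ℝⁿ` (`n ≥ 2`) be a domain and `ℍ` a smooth hypersurface
with `ℍ ∩ Ω ≠ ∅`. If `u` is upper semicontinuous, `v` is subharmonic on `Ω`, and `u ≥ v`
holds `H^{n-1}`-almost everywhere on `ℍ ∩ Ω`, then `u ≥ v` everywhere on `ℍ ∩ Ω`. -/
theorem comparison_on_hypersurface {n : ℕ} (hn : 2 ≤ n)
    (Ω : Set (Eucl n)) (hΩ : IsOpen Ω) (hΩconn : IsConnected Ω)
    (H : Set (Eucl n)) (hH : IsC1Hypersurface H) (hHΩ : (H ∩ Ω).Nonempty)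
    (u : Eucl n → EReal) (hu : UpperSemicontinuousOn u Ω) (hu' : ∀ x ∈ Ω, u x < ⊤)
    (v : Eucl n → EReal) (hv : IsSubharmonicOn v Ω)
    (hae : μH[((n : ℝ) - 1)] {x ∈ H ∩ Ω | ¬ v x ≤ u x} = 0) :
    ∀ x ∈ H ∩ Ω, v x ≤ u x := by

  obtain ⟨d, rfl⟩ : ∃ d, n = d + 1 := ⟨n - 1, by omega⟩
  have hd1 : 1 ≤ d := by omega
  rintro x₀ ⟨hxH, hxΩ⟩
  by_contra hcon
  rw [not_le] at hcon
  obtain ⟨husc, hvtop, -, hcomp⟩ := hv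
  obtain ⟨c, huc, hcv⟩ := EReal.lt_iff_exists_real_btwn.1 hcon
  obtain ⟨b, hb⟩ : ∃ b : ℝ, v x₀ = b :=
    ⟨(v x₀).toReal, (EReal.coe_toReal (hvtop x₀ hxΩ).ne (ne_bot_of_gt hcv)).symm⟩
  have hcb : c < b := by rw [hb] at hcv; exact_mod_cast hcv
  obtain ⟨U, hU, hxU, f, hfU, hf0, hHU⟩ := hH x₀ hxH
  have hfx : f x₀ = 0 := by
    have : x₀ ∈ H ∩ U := ⟨hxH, hxU⟩
    rw [hHU] at this
    exact this.2
  have hstrict : HasStrictFDerivAt f (fderiv ℝ f x₀) x₀ :=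
    (hfU.contDiffAt (hU.mem_nhds hxU)).hasStrictFDerivAt (by norm_num)
  have hf'0 := hf0 x₀ hxU
  generalize fderiv ℝ f x₀ = f' at hstrict hf'0
  have hnhds : ∀ (w : Eucl (d + 1) → EReal), UpperSemicontinuousOn w Ω → ∀ x ∈ Ω, ∀ a : ℝ,
      w x < a → ∀ᶠ y in 𝓝 x, w y < a := by
    intro w hw x hx a ha
    have := hw x hx a ha
    rwa [hΩ.nhdsWithin_eq hx] at this
  have hW : {y | u y < c} ∩ (Ω ∩ U) ∈ 𝓝 x₀ :=
    inter_mem (hnhds u hu x₀ hxΩ c huc) (inter_mem (hΩ.mem_nhds hxΩ) (hU.mem_nhds hxU))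
  obtain ⟨γ, η, hη, hγ1, hγ2⟩ := exists_chart f f' x₀ hstrict hf'0 _ hW
  have hfin : Module.finrank ℝ f'.ker = d := by
    have h1 := LinearMap.finrank_range_add_finrank_ker (f' : Eucl (d + 1) →ₗ[ℝ] ℝ)
    have h2 : LinearMap.range (f' : Eucl (d + 1) →ₗ[ℝ] ℝ) = ⊤ := by
      apply LinearMap.range_eq_top.2
      apply LinearMap.surjective
      intro h
      apply hf'0
      ext x
      exact congrArg (fun g : Eucl (d + 1) →ₗ[ℝ] ℝ => g x) h
    rw [h2, finrank_top, Module.finrank_self, finrank_euclideanSpace_fin] at h1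
    have h3 : Module.finrank ℝ (LinearMap.ker (f' : Eucl (d + 1) →ₗ[ℝ] ℝ)) = d := by omega
    exact h3
  have hnt : Nontrivial f'.ker := Module.nontrivial_of_finrank_pos (R := ℝ) (by omega)
  let μ : Measure f'.ker := μH[(Module.finrank ℝ f'.ker : ℝ)]
  haveI : μ.IsAddHaarMeasure := isAddHaarMeasure_hausdorffMeasure
  obtain ⟨δ, hδ, hbar⟩ := barrier μ hfin (L := 2) (Λ := 2) (by norm_num) (by norm_num)
  set O : Set (Eucl (d + 1)) := {x ∈ Ω | v x < c} with hO
  have hOo : IsOpen O := by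
    rw [isOpen_iff_mem_nhds]
    rintro x ⟨hx, hxc⟩
    exact inter_mem (hΩ.mem_nhds hx) (hnhds v husc x hx c hxc)
  have hxO : x₀ ∉ O := fun h => absurd h.2 hcv.not_gt
  set M : ℝ := b + (b - c) * δ / 2 with hM
  have hbcδ : 0 < (b - c) * δ := mul_pos (by linarith) hδ
  have hMb : v x₀ < (M : EReal) := by
    rw [hb]
    exact_mod_cast (by linarith : b < M)
  obtain ⟨ρ, hρ, hρsub⟩ := Metric.nhds_basis_closedBall.mem_iff.1
    (inter_mem (hΩ.mem_nhds hxΩ) (hnhds v husc x₀ hxΩ M hMb))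
  set r : ℝ := min η (ρ / 6) with hr
  have hr0 : 0 < r := lt_min hη (by linarith)
  have hrη : ball (0 : f'.ker) r ⊆ ball 0 η := ball_subset_ball (min_le_left _ _)
  have hrρ : 3 * 2 * r ≤ ρ := by
    have : r ≤ ρ / 6 := min_le_right _ _
    linarith
  have hnull : μ {s ∈ ball (0 : f'.ker) r | γ s ∉ O} = 0 := by
    have h0 := null_param (d := (Module.finrank ℝ f'.ker : ℝ)) (by positivity) γ (ball 0 r)
      (fun s hs t ht => hγ2 s (hrη hs) t (hrη ht)) {x ∈ H ∩ Ω | ¬ v x ≤ u x} (by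
        rw [hfin]
        have : ((d + 1 : ℕ) : ℝ) - 1 = d := by push_cast; ring
        rw [← this]; exact hae)
    refine measure_mono_null ?_ h0
    rintro s ⟨hs, hsO⟩
    obtain ⟨⟨hs1, hs2, hs3⟩, hs4, -⟩ := hγ1 s (hrη hs)
    refine ⟨hs, ⟨?_, hs2⟩, fun hle => hsO ⟨hs2, hle.trans_lt hs1⟩⟩
    have : γ s ∈ H ∩ U := by
      rw [hHU]
      exact ⟨hs3, hs4.trans hfx⟩
    exact this.1
  obtain ⟨G, q, hGo, hxG, hGb, hqh, hqc, hq1, hq0, hqδ⟩ := hbar r hr0 x₀ γ O hOo hxO hnull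
    (fun s hs => by
      have h1 := (hγ1 s (hrη hs)).2.2
      have h2 : ‖s‖ < r := by simpa using hs
      linarith)
    (fun s hs t ht => hγ2 s (hrη hs) t (hrη ht))
  have hcl : closure G ⊆ closedBall x₀ ρ :=
    closure_minimal (hGb.trans (ball_subset_closedBall.trans (closedBall_subset_closedBall hrρ)))
      isClosed_closedBall
  have hφ := hcomp G hGo ((isCompact_closedBall x₀ ρ).of_isClosed_subset isClosed_closure hcl)
    (fun y hy => (hρsub (hcl hy)).1) (fun y => M + (-(M - c)) * q y)
    ((isHarmonicOn_const M G).add hGo (hqh.const_mul hGo _))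
    (continuousOn_const.add (continuousOn_const.mul hqc)) (by
      intro y hy
      by_cases hyO : y ∈ O
      · refine hyO.2.le.trans ?_
        have := hq1 y hy
        exact_mod_cast (by nlinarith : c ≤ M + (-(M - c)) * q y)
      · have h1 : v y < M := (hρsub (hcl hy.1)).2
        refine h1.le.trans ?_
        have := hq0 y hy hyO
        exact_mod_cast (by nlinarith : M ≤ M + (-(M - c)) * q y)) x₀ hxG
  rw [hb] at hφ
  have hφ' : b ≤ M + (-(M - c)) * q x₀ := by exact_mod_cast hφ
  have h1 : (b - c) * δ ≤ (M - c) * q x₀ := by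
    apply mul_le_mul _ hqδ hδ.le
    · linarith
    · linarith
  linarith

end
end

section
/- Let $n \geq 3$ and identify $\mathbb{R}^{n-2} \times \{0\} \times \{0\}$ with a codimension-2 linear subspace of $\mathbb{R}^n$. There exists a subharmonic function $\widetilde{u}$ on $\mathbb{R}^n$ such that $\widetilde{u}(x) = -2$ for all $x \in (\mathbb{R}^{n-2} \setminus \{0\}) \times \{0\} \times \{0\}$ and $\widetilde{u}(0) = -1$. In particular, with $\widetilde{v} \equiv -2$, one has $\widetilde{v} \geq \widetilde{u}$ almost everywhere on $\mathbb{R}^{n-2} \times \{0\} \times \{0\}$ with respect to the $(n-2)$-dimensional Lebesgue (Hausdorff) measure on that subspace, but $\widetilde{v}(0) < \widetilde{u}(0)$, so the comparison theorem fails for surfaces of co-dimension 2. -/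
open MeasureTheory Metric Filter Set ENNReal Topology

noncomputable section

/-- The inclusion `ℝ^{n-2} → ℝⁿ`, `x ↦ (x, 0, 0)`, identifying `ℝ^{n-2} × {0} × {0}`
with a codimension-2 linear subspace of `ℝⁿ`. -/
noncomputable def incl (n : ℕ) (x : Eucl (n - 2)) : Eucl n :=
  (EuclideanSpace.equiv (Fin n) ℝ).symm
    (fun i => if h : (i : ℕ) < n - 2 then x ⟨(i : ℕ), h⟩ else 0)

/-- Diagonal quadratic form. -/
def qf {n : ℕ} (a : Fin n → ℝ) (x : Eucl n) : ℝ := ∑ i, a i * x i ^ 2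

/-- Coefficients of the last two coordinates. -/
def bb (n : ℕ) (i : Fin n) : ℝ := if (i : ℕ) < n - 2 then 0 else 1

/-- Trace-free coefficients. -/
def aa (n : ℕ) (i : Fin n) : ℝ := if (i : ℕ) < n - 2 then 1 else -(((n : ℝ) - 2) / 2)

lemma sum_bb {n : ℕ} (hn : 3 ≤ n) : ∑ i, bb n i = 2 := by
  obtain ⟨m, rfl⟩ : ∃ m, n = m + 2 := ⟨n - 2, by omega⟩
  rw [Fin.sum_univ_castSucc, Fin.sum_univ_castSucc]
  simp [bb]; norm_num

lemma sum_aa {n : ℕ} (hn : 3 ≤ n) : ∑ i, aa n i = 0 := by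
  obtain ⟨m, rfl⟩ : ∃ m, n = m + 2 := ⟨n - 2, by omega⟩
  rw [Fin.sum_univ_castSucc, Fin.sum_univ_castSucc]
  simp [aa]; ring

lemma hasFDerivAt_coord {n : ℕ} (i : Fin n) (x : Eucl n) :
    HasFDerivAt (fun y : Eucl n => y i) (EuclideanSpace.proj i : Eucl n →L[ℝ] ℝ) x :=
  (EuclideanSpace.proj i : Eucl n →L[ℝ] ℝ).hasFDerivAt

lemma contDiff_qf {n : ℕ} (a : Fin n → ℝ) (k : WithTop ℕ∞) : ContDiff ℝ k (qf a) := by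
  unfold qf
  refine ContDiff.sum fun i _ => contDiff_const.mul (ContDiff.pow ?_ 2)
  exact (EuclideanSpace.proj i : Eucl n →L[ℝ] ℝ).contDiff

lemma continuous_qf {n : ℕ} (a : Fin n → ℝ) : Continuous (qf a) := (contDiff_qf a 0).continuous

lemma fderiv_qf {n : ℕ} (a : Fin n → ℝ) (x : Eucl n) (j : Fin n) :
    fderiv ℝ (qf a) x (EuclideanSpace.single j 1) = 2 * a j * x j := by
  have h : HasFDerivAt (qf a)
      (∑ i, a i • ((2 • x i ^ (2 - 1)) • (EuclideanSpace.proj i : Eucl n →L[ℝ] ℝ))) x := by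
    unfold qf
    exact HasFDerivAt.fun_sum fun i _ => ((hasFDerivAt_coord i x).pow 2).const_mul (a i)
  rw [h.fderiv]
  simp
  ring

lemma differentiableAt_qf {n : ℕ} (a : Fin n → ℝ) (x : Eucl n) : DifferentiableAt ℝ (qf a) x :=
  ((contDiff_qf a 1).differentiable (by norm_num)) x

lemma fderiv_coord {n : ℕ} (i j : Fin n) (x : Eucl n) :
    fderiv ℝ (fun y : Eucl n => y i) x (EuclideanSpace.single j 1) = if i = j then 1 else 0 := by
  rw [(hasFDerivAt_coord i x).fderiv]
  simp

/-- The barrier function. -/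
def ww {n : ℕ} (e c k : ℝ) (x : Eucl n) : ℝ :=
  (qf (aa n) x + e) * Real.log (qf (bb n) x) + c * qf (bb n) x + k

lemma fderiv_ww {n : ℕ} (e c k : ℝ) (x : Eucl n) (hx : qf (bb n) x ≠ 0) (j : Fin n) :
    fderiv ℝ (ww e c k) x (EuclideanSpace.single j 1) =
      (2 * aa n j * Real.log (qf (bb n) x) + (qf (aa n) x + e) * (2 * bb n j) * (qf (bb n) x)⁻¹
        + 2 * c * bb n j) * x j := by
  have h1 := (differentiableAt_qf (aa n) x).hasFDerivAt
  have h2 := (differentiableAt_qf (bb n) x).hasFDerivAt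
  have h := (((h1.add_const e).mul (h2.log hx)).add (h2.const_mul c)).add_const k
  have h' : HasFDerivAt (ww e c k) _ x := h
  rw [h'.fderiv]
  simp [fderiv_qf]
  ring

lemma fderiv2_ww {n : ℕ} (e c k : ℝ) (x : Eucl n) (hx : qf (bb n) x ≠ 0) (j : Fin n) :
    fderiv ℝ (fun y => fderiv ℝ (ww e c k) y (EuclideanSpace.single j 1)) x
      (EuclideanSpace.single j 1) =
      2 * aa n j * Real.log (qf (bb n) x) + (qf (aa n) x + e) * (2 * bb n j) * (qf (bb n) x)⁻¹
        + 2 * c * bb n j + (8 * aa n j * bb n j * (qf (bb n) x)⁻¹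
          - 4 * (qf (aa n) x + e) * bb n j ^ 2 * ((qf (bb n) x)⁻¹) ^ 2) * x j ^ 2 := by
  have hev : (fun y => fderiv ℝ (ww e c k) y (EuclideanSpace.single j 1)) =ᶠ[𝓝 x] fun x =>
      (2 * aa n j * Real.log (qf (bb n) x) + (qf (aa n) x + e) * (2 * bb n j) * (qf (bb n) x)⁻¹
        + 2 * c * bb n j) * x j := by
    filter_upwards [(continuous_qf (bb n)).continuousAt.eventually_ne hx] with y hy
    exact fderiv_ww e c k y hy j
  rw [hev.fderiv_eq]
  have h1 := (differentiableAt_qf (aa n) x).hasFDerivAt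
  have h2 := (differentiableAt_qf (bb n) x).hasFDerivAt
  have hinv := (hasDerivAt_inv hx).comp_hasFDerivAt x h2
  have h := (((((h2.log hx).const_mul (2 * aa n j)).add
    (((h1.add_const e).mul_const (2 * bb n j)).mul hinv)).add_const (2 * c * bb n j)).mul
      (hasFDerivAt_coord j x))
  have h' : HasFDerivAt (fun x : Eucl n =>
      (2 * aa n j * Real.log (qf (bb n) x) + (qf (aa n) x + e) * (2 * bb n j) * (qf (bb n) x)⁻¹
        + 2 * c * bb n j) * x j) _ x := h
  rw [h'.fderiv]
  simp [fderiv_qf]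
  field_simp
  ring

lemma lap_ww {n : ℕ} (hn : 3 ≤ n) (e k : ℝ) (x : Eucl n) (hx : qf (bb n) x ≠ 0) :
    lap (ww e ((n : ℝ) - 1) k) x = 4 := by
  unfold lap
  simp_rw [fderiv2_ww e ((n : ℝ) - 1) k x hx]
  have e1 : ∀ j : Fin n, aa n j * bb n j = -(((n : ℝ) - 2) / 2) * bb n j := by
    intro j; unfold aa bb; split_ifs <;> simp
  have e2 : ∀ j : Fin n, bb n j ^ 2 = bb n j := by
    intro j; unfold bb; split_ifs <;> simp
  have : ∀ j : Fin n, 2 * aa n j * Real.log (qf (bb n) x)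
        + (qf (aa n) x + e) * (2 * bb n j) * (qf (bb n) x)⁻¹
        + 2 * ((n : ℝ) - 1) * bb n j + (8 * aa n j * bb n j * (qf (bb n) x)⁻¹
          - 4 * (qf (aa n) x + e) * bb n j ^ 2 * ((qf (bb n) x)⁻¹) ^ 2) * x j ^ 2
      = (2 * Real.log (qf (bb n) x)) * aa n j
        + (2 * (qf (aa n) x + e) * (qf (bb n) x)⁻¹ + 2 * ((n : ℝ) - 1)) * bb n j
        + (-(4 * ((n : ℝ) - 2)) * (qf (bb n) x)⁻¹
          - 4 * (qf (aa n) x + e) * ((qf (bb n) x)⁻¹) ^ 2) * (bb n j * x j ^ 2) := by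
    intro j
    rw [mul_assoc 8, e1, e2]; ring
  simp_rw [this, Finset.sum_add_distrib, ← Finset.mul_sum]
  rw [sum_aa hn, sum_bb hn]
  change _ + _ * qf (bb n) x = 4
  field_simp
  ring

lemma contDiffAt_ww {n : ℕ} (e c k : ℝ) (x : Eucl n) (hx : qf (bb n) x ≠ 0) :
    ContDiffAt ℝ 2 (ww e c k) x := by
  unfold ww
  have h1 := (contDiff_qf (aa n) 2).contDiffAt (x := x)
  have h2 := (contDiff_qf (bb n) 2).contDiffAt (x := x)
  exact (((h1.add contDiffAt_const).mul (h2.log hx)).add (contDiffAt_const.mul h2)).add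
    contDiffAt_const

lemma lap_qf {n : ℕ} (a : Fin n → ℝ) (e k : ℝ) (x : Eucl n) :
    lap (fun x => e * qf a x + k) x = 2 * e * ∑ i, a i := by
  unfold lap
  rw [Finset.mul_sum]
  refine Finset.sum_congr rfl fun j _ => ?_
  have : (fun y => fderiv ℝ (fun x => e * qf a x + k) y (EuclideanSpace.single j 1)) =
      fun y : Eucl n => (2 * e * a j) * y j := by
    funext y
    rw [(((differentiableAt_qf a y).hasFDerivAt.const_mul e).add_const k).fderiv]
    simp [fderiv_qf]; ring
  rw [this, ((hasFDerivAt_coord j x).const_mul _).fderiv]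
  simp

lemma diffAt_fderiv {n : ℕ} {f : Eucl n → ℝ} {x : Eucl n} (hf : ContDiffAt ℝ 2 f x) (v : Eucl n) :
    DifferentiableAt ℝ (fun y => fderiv ℝ f y v) x := by
  have := (hf.fderiv_right (m := 1) (by norm_num)).differentiableAt (by norm_num)
  exact this.clm_apply (differentiableAt_const v)

lemma lap_sub {n : ℕ} {f g : Eucl n → ℝ} {x : Eucl n} (hf : ContDiffAt ℝ 2 f x)
    (hg : ContDiffAt ℝ 2 g x) : lap (fun y => f y - g y) x = lap f x - lap g x := by
  unfold lap
  rw [← Finset.sum_sub_distrib]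
  refine Finset.sum_congr rfl fun j _ => ?_
  have hev : (fun y => fderiv ℝ (fun y => f y - g y) y (EuclideanSpace.single j 1)) =ᶠ[𝓝 x]
      fun y => fderiv ℝ f y (EuclideanSpace.single j 1) - fderiv ℝ g y (EuclideanSpace.single j 1) := by
    filter_upwards [hf.eventually (by simp), hg.eventually (by simp)] with y h1 h2
    rw [fderiv_fun_sub (h1.differentiableAt (by norm_num)) (h2.differentiableAt (by norm_num))]
    rfl
  rw [hev.fderiv_eq, fderiv_fun_sub (diffAt_fderiv hf _) (diffAt_fderiv hg _)]
  rfl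

lemma second_nonpos {n : ℕ} {f : Eucl n → ℝ} {x : Eucl n} (hf : ContDiffAt ℝ 2 f x)
    (hmax : IsLocalMax f x) (v : Eucl n) : fderiv ℝ (fun y => fderiv ℝ f y v) x v ≤ 0 := by
  by_contra! hpos
  set l : ℝ → Eucl n := fun t => x + t • v with hl
  have hld : ∀ t, HasDerivAt l v t := fun t => by
    have := ((hasDerivAt_id t).smul_const v).const_add x
    rw [one_smul] at this
    exact this
  have hl0 : l 0 = x := by simp [hl]
  have hlc : Tendsto l (𝓝 0) (𝓝 x) := by
    have := (hld 0).continuousAt.tendsto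
    rwa [hl0] at this
  have hd : deriv (fun t => f (l t)) =ᶠ[𝓝 0] fun t => fderiv ℝ f (l t) v := by
    filter_upwards [hlc.eventually (hf.eventually (by simp))] with t ht
    exact ((ht.differentiableAt (by norm_num)).hasFDerivAt.comp_hasDerivAt t (hld t)).deriv
  have hdd : deriv (deriv (fun t => f (l t))) 0 = fderiv ℝ (fun y => fderiv ℝ f y v) x v := by
    rw [hd.deriv_eq]
    have h := (diffAt_fderiv hf v).hasFDerivAt
    rw [← hl0] at h
    have := (h.comp_hasDerivAt (0 : ℝ) (hld 0)).deriv
    rw [← hl0]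
    exact this
  have hlm : IsLocalMax (fun t => f (l t)) 0 := by
    have : ∀ᶠ t in 𝓝 (0 : ℝ), f (l t) ≤ f x := hlc.eventually hmax
    filter_upwards [this] with t ht
    simpa [hl0] using ht
  have hc : ContinuousAt (fun t => f (l t)) 0 := by
    have h1 : ContinuousAt f (l 0) := by rw [hl0]; exact hf.continuousAt
    exact ContinuousAt.comp (f := l) (g := f) h1 (hld 0).continuousAt
  have hmin := isLocalMin_of_deriv_deriv_pos (by rw [hdd]; exact hpos) hlm.deriv_eq_zero hc
  have hconst : (fun t => f (l t)) =ᶠ[𝓝 0] fun _ => f (l 0) := by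
    filter_upwards [hlm, hmin] with t h1 h2
    exact le_antisymm h1 h2
  have : deriv (deriv (fun t => f (l t))) 0 = 0 := by
    rw [hconst.deriv.deriv_eq]; simp
  rw [hdd] at this
  linarith

lemma weak_max {n : ℕ} {U : Set (Eucl n)} (hU : IsOpen U) (hc : IsCompact (closure U))
    {f : Eucl n → ℝ} (hfc : ContinuousOn f (closure U)) (hf : ∀ x ∈ U, ContDiffAt ℝ 2 f x)
    (hlap : ∀ x ∈ U, 0 < lap f x) (hb : ∀ x ∈ frontier U, f x ≤ 0) : ∀ x ∈ U, f x ≤ 0 := by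
  intro x hx
  obtain ⟨z, hz, hzm⟩ := hc.exists_isMaxOn ⟨x, subset_closure hx⟩ hfc
  refine le_trans (hzm (subset_closure hx)) ?_
  by_cases hzU : z ∈ U
  · exfalso
    have hlm : IsLocalMax f z := by
      filter_upwards [hU.mem_nhds hzU] with y hy
      exact hzm (subset_closure hy)
    have := hlap z hzU
    have h2 : lap f z ≤ 0 := Finset.sum_nonpos fun i _ => second_nonpos (hf z hzU) hlm _
    linarith
  · exact hb z (by rw [hU.frontier_eq]; exact ⟨hz, hzU⟩)

/-- Coefficients of the first `n - 2` coordinates. -/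
def cc (n : ℕ) (i : Fin n) : ℝ := 1 - bb n i

/-- The bounded part of the barrier as a function of `s`. -/
def MM (n : ℕ) (s : ℝ) : ℝ := -(((n : ℝ) - 2) / 2) * (s * Real.log s) + ((n : ℝ) - 1) * s

lemma qf_nonneg {n : ℕ} {a : Fin n → ℝ} (ha : ∀ i, 0 ≤ a i) (x : Eucl n) : 0 ≤ qf a x :=
  Finset.sum_nonneg fun i _ => mul_nonneg (ha i) (sq_nonneg _)

lemma bb_nonneg {n : ℕ} (i : Fin n) : 0 ≤ bb n i := by unfold bb; split_ifs <;> simp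

lemma cc_nonneg {n : ℕ} (i : Fin n) : 0 ≤ cc n i := by unfold cc bb; split_ifs <;> simp

lemma qf_aa {n : ℕ} (x : Eucl n) :
    qf (aa n) x = qf (cc n) x - (((n : ℝ) - 2) / 2) * qf (bb n) x := by
  unfold qf
  rw [Finset.mul_sum, ← Finset.sum_sub_distrib]
  refine Finset.sum_congr rfl fun i _ => ?_
  unfold aa cc bb
  split_ifs <;> ring

lemma qf_cc_pos {n : ℕ} {x : Eucl n} (hx : x ≠ 0) (hs : qf (bb n) x = 0) : 0 < qf (cc n) x := by
  have h : qf (cc n) x + qf (bb n) x = ‖x‖ ^ 2 := by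
    rw [EuclideanSpace.norm_sq_eq]
    unfold qf
    rw [← Finset.sum_add_distrib]
    refine Finset.sum_congr rfl fun i _ => ?_
    unfold cc
    simp
    ring
  rw [hs, add_zero] at h
  rw [h]
  positivity

lemma ww_eq {n : ℕ} (e k : ℝ) (x : Eucl n) : ww e ((n : ℝ) - 1) k x =
    qf (cc n) x * Real.log (qf (bb n) x) + e * Real.log (qf (bb n) x) + MM n (qf (bb n) x) + k := by
  unfold ww MM
  rw [qf_aa]
  ring

lemma continuous_MM (n : ℕ) : Continuous (MM n) := by
  unfold MM
  exact (continuous_const.mul Real.continuous_mul_log).add (continuous_const.mul continuous_id)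

lemma MM_nonneg {n : ℕ} (hn : 3 ≤ n) {s : ℝ} (h0 : 0 ≤ s) (h1 : s ≤ 1) : 0 ≤ MM n s := by
  have hn' : (3 : ℝ) ≤ n := by exact_mod_cast hn
  have := Real.log_nonpos h0 h1
  have h2 : 0 ≤ s * -Real.log s := mul_nonneg h0 (by linarith)
  have h3 : 0 ≤ (((n : ℝ) - 2) / 2) * (s * -Real.log s) := mul_nonneg (by linarith) h2
  have h4 : 0 ≤ ((n : ℝ) - 1) * s := mul_nonneg (by linarith) h0
  unfold MM
  linarith

lemma exists_delta (n : ℕ) {e : ℝ} (he : 0 < e) (m : ℝ) :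
    ∃ d : ℝ, 0 < d ∧ d ≤ 1 ∧ ∀ s, 0 < s → s ≤ d → e * Real.log s + MM n s ≤ m := by
  have h1 : Tendsto (fun s => e * Real.log s) (𝓝[>] 0) atBot :=
    Real.tendsto_log_nhdsGT_zero.const_mul_atBot he
  have h2 : Tendsto (MM n) (𝓝[>] 0) (𝓝 (MM n 0)) :=
    (continuous_MM n).continuousAt.tendsto.mono_left nhdsWithin_le_nhds
  have h3 := (h1.atBot_add h2).eventually (eventually_le_atBot m)
  obtain ⟨d, hd, hsub⟩ := mem_nhdsGT_iff_exists_Ioc_subset.1 h3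
  exact ⟨min d 1, lt_min hd one_pos, min_le_right _ _,
    fun s hs hsd => hsub ⟨hs, hsd.trans (min_le_left _ _)⟩⟩

/-- The real-valued subharmonic function of the counterexample. -/
def gg {n : ℕ} (x : Eucl n) : ℝ :=
  open Classical in if qf (bb n) x = 0 ∧ x ≠ 0 then -2 else max (-2) (ww 0 ((n : ℝ) - 1) (-1) x)

lemma gg_ge {n : ℕ} (x : Eucl n) : -2 ≤ gg x := by
  unfold gg
  split_ifs
  · exact le_rfl
  · exact le_max_left _ _

lemma gg_on {n : ℕ} {x : Eucl n} (hs : qf (bb n) x = 0) (hx : x ≠ 0) : gg x = -2 := by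
  unfold gg
  rw [if_pos ⟨hs, hx⟩]

lemma gg_off {n : ℕ} {x : Eucl n} (hs : qf (bb n) x ≠ 0) :
    gg x = max (-2) (ww 0 ((n : ℝ) - 1) (-1) x) := by
  unfold gg
  rw [if_neg (fun h => hs h.1)]

lemma qf_zero {n : ℕ} (a : Fin n → ℝ) : qf a 0 = 0 := by simp [qf]

lemma gg_zero {n : ℕ} : gg (0 : Eucl n) = -1 := by
  unfold gg
  rw [if_neg (fun h => h.2 rfl), ww_eq]
  simp [qf_zero, MM]

lemma gg_usc {n : ℕ} : UpperSemicontinuous (gg : Eucl n → ℝ) := by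
  intro x c hc
  have hsc := continuous_qf (bb n)
  have hc2 : -2 < c := (gg_ge x).trans_lt hc
  by_cases hs : qf (bb n) x = 0
  · by_cases hx : x = 0
    · subst hx
      rw [gg_zero] at hc
      have h1 : ∀ᶠ y : Eucl n in 𝓝 0, qf (bb n) y < 1 :=
        hsc.continuousAt.eventually_lt continuousAt_const (by rw [hs]; norm_num)
      have h2 : ∀ᶠ y : Eucl n in 𝓝 0, MM n (qf (bb n) y) < c + 1 :=
        ((continuous_MM n).comp hsc).continuousAt.eventually_lt continuousAt_const (by
          simp only [Function.comp, hs]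
          simp [MM]; linarith)
      filter_upwards [h1, h2] with y hy1 hy2
      by_cases hy : qf (bb n) y = 0
      · by_cases hy0 : y = 0
        · subst hy0; rw [gg_zero]; exact hc
        · rw [gg_on hy hy0]; exact hc2
      · rw [gg_off hy, ww_eq]
        refine max_lt hc2 ?_
        have hl := Real.log_nonpos (qf_nonneg bb_nonneg y) hy1.le
        have := mul_nonneg (qf_nonneg cc_nonneg y) (neg_nonneg.2 hl)
        linarith
    · have hY := qf_cc_pos hx hs
      obtain ⟨d, hd0, hd1, hd⟩ := exists_delta n (half_pos hY) (-1)
      have h1 : ∀ᶠ y : Eucl n in 𝓝 x, qf (bb n) y < d :=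
        hsc.continuousAt.eventually_lt continuousAt_const (by rw [hs]; exact hd0)
      have h2 : ∀ᶠ y : Eucl n in 𝓝 x, qf (cc n) x / 2 < qf (cc n) y :=
        continuousAt_const.eventually_lt (continuous_qf (cc n)).continuousAt (by linarith)
      have h3 : ∀ᶠ y : Eucl n in 𝓝 x, y ≠ 0 := eventually_ne_nhds hx
      filter_upwards [h1, h2, h3] with y hy1 hy2 hy3
      by_cases hy : qf (bb n) y = 0
      · rw [gg_on hy hy3]; exact hc2
      · rw [gg_off hy, ww_eq]
        refine max_lt hc2 ?_
        have hnn := qf_nonneg bb_nonneg y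
        have hl := Real.log_nonpos hnn (hy1.le.trans hd1)
        have := hd _ (lt_of_le_of_ne hnn (Ne.symm hy)) hy1.le
        have := mul_nonneg (sub_nonneg.2 hy2.le) (neg_nonneg.2 hl)
        nlinarith
  · have hcont : ContinuousAt (fun y => max (-2) (ww 0 ((n : ℝ) - 1) (-1) y)) x :=
      continuousAt_const.max (contDiffAt_ww 0 _ _ x hs).continuousAt
    rw [gg_off hs] at hc
    filter_upwards [hsc.continuousAt.eventually_ne hs,
      hcont.eventually_lt continuousAt_const hc] with y h1 h2
    rw [gg_off h1]; exact h2

lemma step_one {n : ℕ} (hn : 3 ≤ n) {G : Set (Eucl n)} (hG : IsOpen G)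
    (hc : IsCompact (closure G)) {φ : Eucl n → ℝ} (hφ : IsHarmonicOn φ G)
    (hφc : ContinuousOn φ (closure G)) (hb : ∀ x ∈ frontier G, -2 ≤ φ x) :
    ∀ x ∈ G, -2 ≤ φ x := by
  intro x hx
  obtain ⟨S, hS⟩ := hc.bddAbove_image (continuous_qf (bb n)).continuousOn
  have hS' : ∀ y ∈ closure G, qf (bb n) y ≤ S := fun y hy => hS ⟨y, hy, rfl⟩
  refine le_of_forall_pos_le_add fun r hr => ?_
  have hS0 : 0 ≤ S := (qf_nonneg bb_nonneg x).trans (hS' x (subset_closure hx))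
  set e := r / (S + 1) with he
  have he0 : 0 < e := by positivity
  have heS : e * S ≤ r := by
    rw [he, div_mul_eq_mul_div, div_le_iff₀ (by linarith)]
    nlinarith
  have hcd : ∀ y, ContDiffAt ℝ 2 (fun x => e * qf (bb n) x + (-2 - e * S)) y := fun y =>
    ((contDiff_const.mul (contDiff_qf (bb n) 2)).add contDiff_const).contDiffAt
  have key := weak_max hG hc (f := fun y => (e * qf (bb n) y + (-2 - e * S)) - φ y)
    ((((continuous_const.mul (continuous_qf (bb n))).add continuous_const).continuousOn).sub hφc)
    (fun y hy => (hcd y).sub (hφ.1.contDiffAt (hG.mem_nhds hy)))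
    (fun y hy => by
      rw [lap_sub (hcd y) (hφ.1.contDiffAt (hG.mem_nhds hy)), hφ.2 y hy, lap_qf, sum_bb hn]
      linarith)
    (fun y hy => by
      have h1 := hb y hy
      have h2 := mul_le_mul_of_nonneg_left (hS' y (frontier_subset_closure hy)) he0.le
      linarith) x hx
  have h3 := mul_nonneg he0.le (qf_nonneg (bb_nonneg (n := n)) x)
  linarith

lemma step_two {n : ℕ} (hn : 3 ≤ n) {G : Set (Eucl n)} (hG : IsOpen G)
    (hc : IsCompact (closure G)) {φ : Eucl n → ℝ} (hφ : IsHarmonicOn φ G)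
    (hφc : ContinuousOn φ (closure G)) (hb : ∀ x ∈ frontier G, gg x ≤ φ x) :
    ∀ x ∈ G, qf (bb n) x ≠ 0 → ww 0 ((n : ℝ) - 1) (-1) x ≤ φ x := by
  intro x hx hsx
  have hsc := continuous_qf (bb n)
  have hsx0 : 0 < qf (bb n) x := lt_of_le_of_ne (qf_nonneg bb_nonneg x) (Ne.symm hsx)
  obtain ⟨S, hS⟩ := hc.bddAbove_image hsc.continuousOn
  have hS' : ∀ y ∈ closure G, Real.log (qf (bb n) y) ≤ S := fun y hy =>
    (Real.log_le_self (qf_nonneg bb_nonneg y)).trans (hS ⟨y, hy, rfl⟩)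
  have hS0 : 0 ≤ S := (qf_nonneg bb_nonneg x).trans (hS ⟨x, subset_closure hx, rfl⟩)
  obtain ⟨m, hm⟩ := hc.bddBelow_image hφc
  have hm' : ∀ y ∈ closure G, m ≤ φ y := fun y hy => hm ⟨y, hy, rfl⟩
  have hrel : ∀ e y, ww e ((n : ℝ) - 1) (-1 - e * S) y =
      ww 0 ((n : ℝ) - 1) (-1) y + e * (Real.log (qf (bb n) y) - S) := by
    intro e y; unfold ww; ring
  have main : ∀ e, 0 < e → ww e ((n : ℝ) - 1) (-1 - e * S) x ≤ φ x := by
    intro e he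
    obtain ⟨d, hd0, hd1, hd⟩ := exists_delta n he m
    have small : ∀ y ∈ closure G, 0 < qf (bb n) y → qf (bb n) y ≤ d →
        ww e ((n : ℝ) - 1) (-1 - e * S) y ≤ φ y := by
      intro y hy h0 h1
      rw [ww_eq]
      have hl := Real.log_nonpos h0.le (h1.trans hd1)
      have h2 := mul_nonneg (qf_nonneg (cc_nonneg (n := n)) y) (neg_nonneg.2 hl)
      have h3 := hd _ h0 h1
      have h4 := hm' y hy
      have h5 := mul_nonneg he.le hS0
      linarith
    by_cases hxd : qf (bb n) x ≤ d
    · exact small x (subset_closure hx) hsx0 hxd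
    have hU : IsOpen (G ∩ {y | d < qf (bb n) y}) := hG.inter (isOpen_lt continuous_const hsc)
    have hUG : closure (G ∩ {y | d < qf (bb n) y}) ⊆ closure G := closure_mono inter_subset_left
    have hUd : ∀ y ∈ closure (G ∩ {y | d < qf (bb n) y}), d ≤ qf (bb n) y := by
      intro y hy
      have : closure (G ∩ {y | d < qf (bb n) y}) ⊆ {y | d ≤ qf (bb n) y} :=
        closure_minimal (fun z hz => (show d < qf (bb n) z from hz.2).le) (isClosed_le continuous_const hsc)
      exact this hy
    have hcd : ∀ y ∈ closure (G ∩ {y | d < qf (bb n) y}),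
        ContDiffAt ℝ 2 (ww e ((n : ℝ) - 1) (-1 - e * S)) y := fun y hy =>
      contDiffAt_ww _ _ _ y (hd0.trans_le (hUd y hy)).ne'
    have key := weak_max hU (hc.of_isClosed_subset isClosed_closure hUG)
      (f := fun y => ww e ((n : ℝ) - 1) (-1 - e * S) y - φ y)
      (ContinuousOn.sub (fun y hy => (hcd y hy).continuousAt.continuousWithinAt) (hφc.mono hUG))
      (fun y hy => (hcd y (subset_closure hy)).sub (hφ.1.contDiffAt (hG.mem_nhds hy.1)))
      (fun y hy => by
        rw [lap_sub (hcd y (subset_closure hy)) (hφ.1.contDiffAt (hG.mem_nhds hy.1)),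
          hφ.2 y hy.1, lap_ww hn _ _ _ (hd0.trans_le (hUd y (subset_closure hy))).ne']
        norm_num)
      (fun y hy => by
        rw [hU.frontier_eq] at hy
        have hyd := hUd y hy.1
        have hyG := hUG hy.1
        rw [sub_nonpos]
        by_cases hyg : y ∈ G
        · refine small y hyG (hd0.trans_le hyd) ?_
          by_contra h
          exact hy.2 ⟨hyg, not_le.1 h⟩
        · have h1 := hb y (by rw [hG.frontier_eq]; exact ⟨hyG, hyg⟩)
          rw [gg_off (hd0.trans_le hyd).ne'] at h1
          have h2 := (le_max_right _ _).trans h1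
          have h3 := mul_nonneg he.le (sub_nonneg.2 (hS' y hyG))
          rw [hrel]
          linarith) x ⟨hx, not_le.1 hxd⟩
    exact sub_nonpos.1 key
  refine le_of_forall_pos_le_add fun r hr => ?_
  have hK := sub_nonneg.2 (hS' x (subset_closure hx))
  set K := S - Real.log (qf (bb n) x) with hKdef
  have h1 := main (r / (K + 1)) (by positivity)
  rw [hrel] at h1
  have h2 : r / (K + 1) * K ≤ r := by
    rw [div_mul_eq_mul_div, div_le_iff₀ (by linarith)]
    nlinarith
  have h3 : Real.log (qf (bb n) x) - S = -K := by rw [hKdef]; ring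
  rw [h3] at h1
  linarith

lemma step_three {n : ℕ} (hn : 3 ≤ n) {G : Set (Eucl n)} (hG : IsOpen G)
    {φ : Eucl n → ℝ} (hφc : ContinuousOn φ (closure G)) (h0 : (0 : Eucl n) ∈ G)
    (hb : ∀ x ∈ G, qf (bb n) x ≠ 0 → ww 0 ((n : ℝ) - 1) (-1) x ≤ φ x) : -1 ≤ φ 0 := by
  set j : Fin n := ⟨n - 1, by omega⟩ with hj
  have hbj : bb n j = 1 := by unfold bb; rw [if_neg]; simp [hj]; omega
  have hq : ∀ (a : Fin n → ℝ) (t : ℝ), qf a (EuclideanSpace.single j t) = a j * t ^ 2 := by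
    intro a t
    unfold qf
    rw [Finset.sum_eq_single j]
    · simp
    · intro i _ hi; simp [hi]
    · simp
  have hcont : Continuous (fun t : ℝ => t • (EuclideanSpace.single j 1 : Eucl n)) := by fun_prop
  have hsm : ∀ t : ℝ, t • (EuclideanSpace.single j 1 : Eucl n) = EuclideanSpace.single j t := by
    intro t; ext i; by_cases h : i = j <;> simp [h]
  have ht : Tendsto (fun t : ℝ => t • (EuclideanSpace.single j 1 : Eucl n)) (𝓝[>] 0) (𝓝 0) := by
    have := hcont.continuousAt (x := (0 : ℝ)) |>.tendsto.mono_left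
      (nhdsWithin_le_nhds (s := Ioi (0 : ℝ)))
    simpa using this
  have hφ0 : ContinuousAt φ 0 :=
    hφc.continuousAt (mem_of_superset (hG.mem_nhds h0) subset_closure)
  refine ge_of_tendsto (hφ0.tendsto.comp ht) ?_
  filter_upwards [ht.eventually (hG.mem_nhds h0), Ioc_mem_nhdsGT (zero_lt_one' ℝ)] with t h1 h2
  have h3 : qf (bb n) (t • (EuclideanSpace.single j 1 : Eucl n)) = t ^ 2 := by
    rw [hsm, hq, hbj, one_mul]
  have h4 : qf (cc n) (t • (EuclideanSpace.single j 1 : Eucl n)) = 0 := by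
    rw [hsm, hq]; simp [cc, hbj]
  have h5 := hb _ h1 (by rw [h3]; exact (pow_pos h2.1 2).ne')
  rw [ww_eq, h3, h4] at h5
  have h6 := MM_nonneg hn (sq_nonneg t) (pow_le_one₀ h2.1.le h2.2)
  simp only [Function.comp]
  linarith

lemma gg_sub {n : ℕ} (hn : 3 ≤ n) {G : Set (Eucl n)} (hG : IsOpen G)
    (hc : IsCompact (closure G)) {φ : Eucl n → ℝ} (hφ : IsHarmonicOn φ G)
    (hφc : ContinuousOn φ (closure G)) (hb : ∀ x ∈ frontier G, gg x ≤ φ x) :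
    ∀ x ∈ G, gg x ≤ φ x := by
  intro x hx
  have h1 := step_one hn hG hc hφ hφc (fun y hy => (gg_ge y).trans (hb y hy))
  have h2 := step_two hn hG hc hφ hφc hb
  by_cases hs : qf (bb n) x = 0
  · by_cases hx0 : x = 0
    · subst hx0
      rw [gg_zero]
      exact step_three hn hG hφc hx h2
    · rw [gg_on hs hx0]; exact h1 x hx
  · rw [gg_off hs]; exact max_le (h1 x hx) (h2 x hx hs)

lemma gg_eusc {n : ℕ} : UpperSemicontinuous (fun x : Eucl n => ((gg x : ℝ) : EReal)) :=
  continuous_coe_real_ereal.comp_upperSemicontinuous gg_usc EReal.coe_strictMono.monotone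

lemma qf_incl {n : ℕ} (x : Eucl (n - 2)) : qf (bb n) (incl n x) = 0 := by
  unfold qf
  refine Finset.sum_eq_zero fun i _ => ?_
  unfold bb incl
  split_ifs with h <;> simp [h]

lemma incl_zero {n : ℕ} : incl n 0 = 0 := by
  ext i; simp [incl]

lemma incl_ne {n : ℕ} {x : Eucl (n - 2)} (hx : x ≠ 0) : incl n x ≠ 0 := by
  intro h
  apply hx
  ext i
  have hi : (i : ℕ) < n := by omega
  have := congrArg (fun y : Eucl n => y ⟨i, hi⟩) h
  simpa [incl] using this

lemma continuous_incl {n : ℕ} : Continuous (incl n) := by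
  unfold incl
  refine (EuclideanSpace.equiv (Fin n) ℝ).symm.continuous.comp (continuous_pi fun i => ?_)
  split_ifs <;> fun_prop

/-- **Counterexample (Example 4.3).** For `n ≥ 3` there is a function `ũ` subharmonic on
all of `ℝⁿ` with `ũ = -2` on `(ℝ^{n-2} \ {0}) × {0} × {0}` and `ũ(0) = -1`. In
particular, with `ṽ ≡ -2`, the set where `ṽ ≥ ũ` fails has measure zero for the
`(n-2)`-dimensional Lebesgue measure on the subspace (the pushforward of the Lebesgue
measure of `ℝ^{n-2}` under `x ↦ (x,0,0)`), yet `ṽ(0) < ũ(0)`: the comparison theorem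
fails in co-dimension `2`. -/
theorem counterexample_codim_two {n : ℕ} (hn : 3 ≤ n) :
    ∃ u : Eucl n → EReal, IsSubharmonicOn u Set.univ ∧
      (∀ x : Eucl (n - 2), x ≠ 0 → u (incl n x) = (-2 : EReal)) ∧
      u (incl n 0) = (-1 : EReal) ∧
      (Measure.map (incl n) (volume : Measure (Eucl (n - 2))))
          {y : Eucl n | ¬ u y ≤ (-2 : EReal)} = 0 ∧
      (-2 : EReal) < u (incl n 0) := by
  have e2 : ((-2 : ℝ) : EReal) = -2 := by push_cast; rfl
  have e1 : ((-1 : ℝ) : EReal) = -1 := by push_cast; rfl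
  have hon : ∀ x : Eucl (n - 2), x ≠ 0 → ((gg (incl n x) : ℝ) : EReal) = -2 := by
    intro x hx
    rw [gg_on (qf_incl x) (incl_ne hx), e2]
  have h0 : ((gg (incl n 0) : ℝ) : EReal) = -1 := by rw [incl_zero, gg_zero, e1]
  refine ⟨fun x => ((gg x : ℝ) : EReal), ⟨gg_eusc.upperSemicontinuousOn _,
    fun x _ => EReal.coe_lt_top _, ⟨0, mem_univ _, EReal.coe_ne_bot _⟩, ?_⟩, hon, h0, ?_, ?_⟩
  · intro G hG hc _ φ hφ hφc hb x hx
    exact EReal.coe_le_coe_iff.2 (gg_sub hn hG hc hφ hφc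
      (fun y hy => EReal.coe_le_coe_iff.1 (hb y hy)) x hx)
  · have hm : MeasurableSet {y : Eucl n | ¬ ((gg y : ℝ) : EReal) ≤ -2} :=
      (measurableSet_le gg_eusc.measurable measurable_const).compl
    rw [Measure.map_apply continuous_incl.measurable hm]
    have hne : Nonempty (Fin (n - 2)) := ⟨⟨0, by omega⟩⟩
    refine measure_mono_null (t := {0}) (fun x hx => ?_) (measure_singleton _)
    by_contra h
    exact hx (hon x h).le
  · change (-2 : EReal) < ((gg (incl n 0) : ℝ) : EReal)
    rw [h0, ← e1, ← e2]
    exact EReal.coe_lt_coe_iff.2 (by norm_num)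

end
end

section
/- Let $n \geq 3$, let $i \geq 2$ be an integer, and let $\mu_i$ be the measure on $\mathbb{R}^n$ obtained as the pushforward, under the inclusion $x \mapsto (x,0,0)$, of the $(n-2)$-dimensional Lebesgue measure on the annulus $\mathbb{B}_{n-2}(0,i) \setminus \mathbb{B}_{n-2}(0,1/i) \subset \mathbb{R}^{n-2}$. Define $p_{\mu_i}(x) = \int_{\mathbb{R}^n} \frac{-1}{|x-w|^{n-2}}\, d\mu_i(w)$. Then $p_{\mu_i}$ is subharmonic on $\mathbb{R}^n$, $p_{\mu_i} \leq 0$ on $\mathbb{R}^n$, $p_{\mu_i} = -\infty$ on $(\mathbb{B}_{n-2}(0,i) \setminus \mathbb{B}_{n-2}(0,1/i)) \times \{0\} \times \{0\}$, and $-\infty < p_{\mu_i}(0) < 0$. -/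
open MeasureTheory Metric Filter Set ENNReal Topology

noncomputable section

/-- The measure `μᵢ` on `ℝⁿ`: the pushforward, under `x ↦ (x,0,0)`, of the
`(n-2)`-dimensional Lebesgue measure on the annulus `B_{n-2}(0,i) \ B_{n-2}(0,1/i)`. -/
noncomputable def annulusMeasure (n : ℕ) (i : ℕ) : Measure (Eucl n) :=
  Measure.map (incl n)
    ((volume : Measure (Eucl (n - 2))).restrict
      (Metric.ball (0 : Eucl (n - 2)) (i : ℝ) \ Metric.ball 0 (1 / (i : ℝ))))

/-- The Newtonian-type potential `p_μ(x) = ∫ -1/|x-w|^{n-2} dμ(w)`, with values in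
`[-∞, 0]` (the integrand is nonpositive). -/
noncomputable def potential (n : ℕ) (μ : Measure (Eucl n)) (x : Eucl n) : EReal :=
  - (((∫⁻ w, ENNReal.ofReal (1 / ‖x - w‖ ^ (n - 2)) ∂μ : ℝ≥0∞)) : EReal)


lemma second_deriv_nonpos (h h' : ℝ → ℝ) (c : ℝ) (h1 : ∀ᶠ t in 𝓝 (0:ℝ), HasDerivAt h (h' t) t)
    (h2 : HasDerivAt h' c 0) (hmax : IsLocalMax h 0) : c ≤ 0 := by
  by_contra hc
  push Not at hc
  have e1 : deriv h =ᶠ[𝓝 0] h' := h1.mono fun t ht => ht.deriv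
  have e2 : deriv (deriv h) 0 = c := by rw [e1.deriv_eq, h2.deriv]
  have hmin : IsLocalMin h 0 := isLocalMin_of_deriv_deriv_pos (by rw [e2]; exact hc)
    hmax.deriv_eq_zero h1.self_of_nhds.continuousAt
  have e3 : h =ᶠ[𝓝 0] fun _ => h 0 := by
    filter_upwards [hmax, hmin] with t a b using le_antisymm a b
  have e4 := e3.deriv.deriv_eq
  rw [e2] at e4
  simp at e4
  linarith

/-- regularized kernel -/
def Kr (p s : ℝ) {n : ℕ} (y : Eucl n) : ℝ := (‖y‖ ^ 2 + s) ^ p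

lemma q_pos {n : ℕ} {s : ℝ} (hs : 0 < s) (y : Eucl n) : 0 < ‖y‖ ^ 2 + s := by positivity

lemma Kr_hasDeriv {n : ℕ} {p s : ℝ} (hs : 0 < s) (y e : Eucl n) (t : ℝ) :
    HasDerivAt (fun t : ℝ => Kr p s (y + t • e))
      (p * (‖y + t • e‖ ^ 2 + s) ^ (p - 1) * (2 * inner ℝ (y + t • e) e)) t := by
  have h0 : HasDerivAt (fun t : ℝ => y + t • e) e t := by
    simpa using ((hasDerivAt_id t).smul_const e).const_add y
  have h1 := (h0.norm_sq.add_const s).rpow_const (p := p) (Or.inl (q_pos hs _).ne')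
  exact h1.congr_deriv (by ring)

lemma Kr_hasDeriv2 {n : ℕ} {p s : ℝ} (hs : 0 < s) (y e : Eucl n) (he : ‖e‖ = 1) (t : ℝ) :
    HasDerivAt (fun t : ℝ => p * (‖y + t • e‖ ^ 2 + s) ^ (p - 1) * (2 * inner ℝ (y + t • e) e))
      (p * (p - 1) * (‖y + t • e‖ ^ 2 + s) ^ (p - 2) * (2 * inner ℝ (y + t • e) e) ^ 2 +
        2 * p * (‖y + t • e‖ ^ 2 + s) ^ (p - 1)) t := by
  have h0 : HasDerivAt (fun t : ℝ => y + t • e) e t := by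
    simpa using ((hasDerivAt_id t).smul_const e).const_add y
  have h1 := (h0.norm_sq.add_const s).rpow_const (p := p - 1) (Or.inl (q_pos hs _).ne')
  have h2 := h0.inner ℝ (hasDerivAt_const t e)
  have h3 := (h1.const_mul p).mul (h2.const_mul 2)
  refine h3.congr_deriv ?_
  rw [show p - 1 - 1 = p - 2 by ring]
  simp [he]
  ring

lemma Kr_bd {n : ℕ} {p s : ℝ} (hp : p ≤ 0) (hs : 0 < s) (y : Eucl n) :
    (‖y‖ ^ 2 + s) ^ p ≤ s ^ p :=
  Real.rpow_le_rpow_of_nonpos hs (by nlinarith [sq_nonneg ‖y‖]) hp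

lemma inner_sq_le {n : ℕ} {s : ℝ} (hs : 0 < s) (y e : Eucl n) (he : ‖e‖ = 1) :
    (inner ℝ y e) ^ 2 ≤ ‖y‖ ^ 2 + s := by
  have h := abs_real_inner_le_norm y e
  rw [he, mul_one] at h
  have := sq_abs (inner ℝ y e)
  nlinarith [abs_nonneg (inner ℝ y e)]

lemma Kr_bd1 {n : ℕ} {p s : ℝ} (hp : p ≤ 0) (hs : 0 < s) (y e : Eucl n) (he : ‖e‖ = 1) :
    ‖p * (‖y‖ ^ 2 + s) ^ (p - 1) * (2 * inner ℝ y e)‖ ≤ -p * (s ^ (p - 1) + s ^ p) := by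
  have hq := q_pos hs y
  have h1 := inner_sq_le hs y e he
  have h2 : |2 * inner ℝ y e| ≤ 1 + (‖y‖ ^ 2 + s) := by
    rw [abs_le]; constructor <;> nlinarith [sq_nonneg (inner ℝ y e - 1), sq_nonneg (inner ℝ y e + 1)]
  have h3 : 0 < (‖y‖ ^ 2 + s) ^ (p - 1) := Real.rpow_pos_of_pos hq _
  rw [Real.norm_eq_abs, abs_mul, abs_mul, abs_of_nonpos hp, abs_of_pos h3, mul_assoc]
  apply mul_le_mul_of_nonneg_left _ (by linarith)
  calc _ ≤ (‖y‖ ^ 2 + s) ^ (p - 1) * (1 + (‖y‖ ^ 2 + s)) := mul_le_mul_of_nonneg_left h2 h3.le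
    _ = (‖y‖ ^ 2 + s) ^ (p - 1) + (‖y‖ ^ 2 + s) ^ p := by
      rw [mul_add, mul_one]; congr 1
      rw [Real.rpow_sub_one hq.ne']; field_simp
    _ ≤ _ := add_le_add (Kr_bd (by linarith) hs y) (Kr_bd hp hs y)

lemma Kr_bd2 {n : ℕ} {p s : ℝ} (hp : p ≤ 0) (hs : 0 < s) (y e : Eucl n) (he : ‖e‖ = 1) :
    ‖p * (p - 1) * (‖y‖ ^ 2 + s) ^ (p - 2) * (2 * inner ℝ y e) ^ 2 +
        2 * p * (‖y‖ ^ 2 + s) ^ (p - 1)‖ ≤ (4 * (p * (p - 1)) - 2 * p) * s ^ (p - 1) := by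
  have hq := q_pos hs y
  have h1 := inner_sq_le hs y e he
  have h3 : 0 < (‖y‖ ^ 2 + s) ^ (p - 2) := Real.rpow_pos_of_pos hq _
  have h4 : 0 < (‖y‖ ^ 2 + s) ^ (p - 1) := Real.rpow_pos_of_pos hq _
  have h5 : (‖y‖ ^ 2 + s) ^ (p - 2) * (‖y‖ ^ 2 + s) = (‖y‖ ^ 2 + s) ^ (p - 1) := by
    rw [show p - 2 = p - 1 - 1 by ring, Real.rpow_sub_one hq.ne' (p - 1)]; field_simp
  have h6 := Kr_bd (p := p - 1) (by linarith) hs y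
  have h7 : 0 ≤ p * (p - 1) := by nlinarith
  have h8 : (‖y‖ ^ 2 + s) ^ (p - 2) * (inner ℝ y e) ^ 2 ≤ (‖y‖ ^ 2 + s) ^ (p - 1) := by
    rw [← h5]; exact mul_le_mul_of_nonneg_left h1 h3.le
  have h9 : 0 ≤ (‖y‖ ^ 2 + s) ^ (p - 2) * (inner ℝ y e) ^ 2 := by positivity
  generalize (‖y‖ ^ 2 + s) ^ (p - 2) = A at *
  generalize (‖y‖ ^ 2 + s) ^ (p - 1) = B at *
  generalize inner ℝ y e = c at *
  rw [Real.norm_eq_abs]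
  have e1 : p * (p - 1) * A * (2 * c) ^ 2 = 4 * ((p * (p - 1)) * (A * c ^ 2)) := by ring
  rw [e1]
  have h10 : (p * (p - 1)) * (A * c ^ 2) ≤ (p * (p - 1)) * s ^ (p - 1) :=
    mul_le_mul_of_nonneg_left (h8.trans h6) h7
  have h11 : 0 ≤ (p * (p - 1)) * (A * c ^ 2) := mul_nonneg h7 h9
  have h12 : (-p) * B ≤ (-p) * s ^ (p - 1) := mul_le_mul_of_nonneg_left h6 (by linarith)
  have h13 : 0 ≤ (-p) * B := mul_nonneg (by linarith) h4.le
  rw [abs_le]; constructor <;> nlinarith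

/-- Laplacian computation -/
lemma Kr_lap {n : ℕ} {s : ℝ} (hs : 0 < s) (y : Eucl n) (p : ℝ) (hp : p = -((n:ℝ) - 2) / 2) :
    ∑ i : Fin n, (p * (p - 1) * (‖y‖ ^ 2 + s) ^ (p - 2) *
        (2 * inner ℝ y (EuclideanSpace.single i (1:ℝ))) ^ 2 +
        2 * p * (‖y‖ ^ 2 + s) ^ (p - 1)) = 2 * p * n * s * (‖y‖ ^ 2 + s) ^ (p - 2) := by
  have hq := q_pos hs y
  have h5 : (‖y‖ ^ 2 + s) ^ (p - 1) = (‖y‖ ^ 2 + s) ^ (p - 2) * (‖y‖ ^ 2 + s) := by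
    rw [show p - 2 = p - 1 - 1 by ring, Real.rpow_sub_one hq.ne' (p - 1)]; field_simp
  rw [Finset.sum_add_distrib, ← Finset.mul_sum]
  have : ∑ i : Fin n, (2 * inner ℝ y (EuclideanSpace.single i (1:ℝ))) ^ 2 = 4 * ‖y‖ ^ 2 := by
    rw [EuclideanSpace.norm_sq_eq, Finset.mul_sum]
    refine Finset.sum_congr rfl fun i _ => ?_
    simp [EuclideanSpace.inner_single_right]
    ring
  rw [this, h5]
  simp
  generalize (‖y‖ ^ 2 + s) ^ (p - 2) = A
  subst hp
  ring

lemma Kr_cont {n : ℕ} {p s : ℝ} (hs : 0 < s) : Continuous (fun y : Eucl n => (‖y‖ ^ 2 + s) ^ p) := by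
  refine Continuous.rpow_const (by fun_prop) fun y => Or.inl (q_pos hs y).ne'

/-- regularized potential -/
def Pr {n : ℕ} (μ : Measure (Eucl n)) (p s : ℝ) (x : Eucl n) : ℝ := ∫ w, Kr p s (x - w) ∂μ

lemma Kr_nonneg {n : ℕ} {p s : ℝ} (hs : 0 < s) (y : Eucl n) : 0 < Kr p s y :=
  Real.rpow_pos_of_pos (q_pos hs y) _

lemma Kr_int {n : ℕ} (μ : Measure (Eucl n)) [IsFiniteMeasure μ] {p s : ℝ} (hp : p ≤ 0) (hs : 0 < s)
    (x : Eucl n) : Integrable (fun w => Kr p s (x - w)) μ := by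
  refine Integrable.of_bound (C := s ^ p)
    ((Kr_cont hs).comp (continuous_const.sub continuous_id)).aestronglyMeasurable ?_
  refine Eventually.of_forall fun w => ?_
  rw [Real.norm_eq_abs, abs_of_pos (Kr_nonneg hs _)]
  exact Kr_bd hp hs _

lemma Pr_cont {n : ℕ} (μ : Measure (Eucl n)) [IsFiniteMeasure μ] {p s : ℝ} (hp : p ≤ 0) (hs : 0 < s) :
    Continuous (Pr μ p s) := by
  refine continuous_of_dominated (bound := fun _ => s ^ p)
    (fun x => (Kr_int μ hp hs x).aestronglyMeasurable) ?_ (integrable_const _) ?_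
  · refine fun x => Eventually.of_forall fun w => ?_
    rw [Real.norm_eq_abs, abs_of_pos (Kr_nonneg hs _)]
    exact Kr_bd hp hs _
  · exact Eventually.of_forall fun w => (Kr_cont hs).comp (continuous_id.sub continuous_const)

/-- first derivative of the kernel in direction `e` -/
def D1 (p s : ℝ) {n : ℕ} (e y : Eucl n) : ℝ := p * (‖y‖ ^ 2 + s) ^ (p - 1) * (2 * inner ℝ y e)

/-- second derivative of the kernel in direction `e` -/
def D2 (p s : ℝ) {n : ℕ} (e y : Eucl n) : ℝ :=
  p * (p - 1) * (‖y‖ ^ 2 + s) ^ (p - 2) * (2 * inner ℝ y e) ^ 2 +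
        2 * p * (‖y‖ ^ 2 + s) ^ (p - 1)

lemma D1_cont {n : ℕ} {p s : ℝ} (hs : 0 < s) (e : Eucl n) : Continuous (D1 p s e) := by
  have := Kr_cont (n := n) (p := p - 1) hs
  unfold D1
  fun_prop

lemma D2_cont {n : ℕ} {p s : ℝ} (hs : 0 < s) (e : Eucl n) : Continuous (D2 p s e) := by
  have := Kr_cont (n := n) (p := p - 1) hs
  have := Kr_cont (n := n) (p := p - 2) hs
  unfold D2
  fun_prop

lemma D1_int {n : ℕ} (μ : Measure (Eucl n)) [IsFiniteMeasure μ] {p s : ℝ} (hp : p ≤ 0) (hs : 0 < s)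
    (x e : Eucl n) (he : ‖e‖ = 1) : Integrable (fun w => D1 p s e (x - w)) μ :=
  Integrable.of_bound 
    ((D1_cont hs e).comp (continuous_const.sub continuous_id)).aestronglyMeasurable _
    (Eventually.of_forall fun _ => Kr_bd1 hp hs _ e he)

lemma D2_int {n : ℕ} (μ : Measure (Eucl n)) [IsFiniteMeasure μ] {p s : ℝ} (hp : p ≤ 0) (hs : 0 < s)
    (x e : Eucl n) (he : ‖e‖ = 1) : Integrable (fun w => D2 p s e (x - w)) μ :=
  Integrable.of_bound 
    ((D2_cont hs e).comp (continuous_const.sub continuous_id)).aestronglyMeasurable _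
    (Eventually.of_forall fun _ => Kr_bd2 hp hs _ e he)

lemma Pr_deriv {n : ℕ} (μ : Measure (Eucl n)) [IsFiniteMeasure μ] {p s : ℝ} (hp : p ≤ 0) (hs : 0 < s)
    (x e : Eucl n) (he : ‖e‖ = 1) (t : ℝ) :
    HasDerivAt (fun t : ℝ => Pr μ p s (x + t • e)) (∫ w, D1 p s e (x + t • e - w) ∂μ) t := by
  have a1 : ∀ᶠ t in 𝓝 t, AEStronglyMeasurable ((fun (t : ℝ) w => Kr p s (x + t • e - w)) t) μ :=
    Eventually.of_forall fun t => (Kr_int μ hp hs _).aestronglyMeasurable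
  have a2 : Integrable ((fun (t : ℝ) w => Kr p s (x + t • e - w)) t) μ := Kr_int μ hp hs _
  have a3 : AEStronglyMeasurable ((fun (t : ℝ) w => D1 p s e (x + t • e - w)) t) μ :=
    (D1_int μ hp hs _ e he).aestronglyMeasurable
  have a4 : ∀ᵐ w ∂μ, ∀ t ∈ (univ : Set ℝ), ‖(fun (t : ℝ) w => D1 p s e (x + t • e - w)) t w‖ ≤
      (fun _ : Eucl n => -p * (s ^ (p - 1) + s ^ p)) w :=
    Eventually.of_forall fun w t _ => Kr_bd1 hp hs _ e he
  have a5 : Integrable (fun _ : Eucl n => -p * (s ^ (p - 1) + s ^ p)) μ := integrable_const _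
  have a6 : ∀ᵐ w ∂μ, ∀ t ∈ (univ : Set ℝ),
      HasDerivAt (fun t => (fun (t : ℝ) w => Kr p s (x + t • e - w)) t w)
        ((fun (t : ℝ) w => D1 p s e (x + t • e - w)) t w) t := by
    refine Eventually.of_forall fun w t _ => ?_
    have := Kr_hasDeriv (p := p) hs (x - w) e t
    simp only [sub_add_eq_add_sub] at this
    exact this
  exact (hasDerivAt_integral_of_dominated_loc_of_deriv_le univ_mem a1 a2 a3 a4 a5 a6).2

lemma Pr_deriv2 {n : ℕ} (μ : Measure (Eucl n)) [IsFiniteMeasure μ] {p s : ℝ} (hp : p ≤ 0) (hs : 0 < s)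
    (x e : Eucl n) (he : ‖e‖ = 1) (t : ℝ) :
    HasDerivAt (fun t : ℝ => ∫ w, D1 p s e (x + t • e - w) ∂μ) (∫ w, D2 p s e (x + t • e - w) ∂μ) t := by
  have a1 : ∀ᶠ t in 𝓝 t, AEStronglyMeasurable ((fun (t : ℝ) w => D1 p s e (x + t • e - w)) t) μ :=
    Eventually.of_forall fun t => (D1_int μ hp hs _ e he).aestronglyMeasurable
  have a2 : Integrable ((fun (t : ℝ) w => D1 p s e (x + t • e - w)) t) μ := D1_int μ hp hs _ e he
  have a3 : AEStronglyMeasurable ((fun (t : ℝ) w => D2 p s e (x + t • e - w)) t) μ :=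
    (D2_int μ hp hs _ e he).aestronglyMeasurable
  have a4 : ∀ᵐ w ∂μ, ∀ t ∈ (univ : Set ℝ), ‖(fun (t : ℝ) w => D2 p s e (x + t • e - w)) t w‖ ≤
      (fun _ : Eucl n => (4 * (p * (p - 1)) - 2 * p) * s ^ (p - 1)) w :=
    Eventually.of_forall fun w t _ => Kr_bd2 hp hs _ e he
  have a5 : Integrable (fun _ : Eucl n => (4 * (p * (p - 1)) - 2 * p) * s ^ (p - 1)) μ := integrable_const _
  have a6 : ∀ᵐ w ∂μ, ∀ t ∈ (univ : Set ℝ),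
      HasDerivAt (fun t => (fun (t : ℝ) w => D1 p s e (x + t • e - w)) t w)
        ((fun (t : ℝ) w => D2 p s e (x + t • e - w)) t w) t := by
    refine Eventually.of_forall fun w t _ => ?_
    have := Kr_hasDeriv2 (p := p) hs (x - w) e he t
    simp only [sub_add_eq_add_sub] at this
    exact this
  exact (hasDerivAt_integral_of_dominated_loc_of_deriv_le univ_mem a1 a2 a3 a4 a5 a6).2

lemma sum_D2_neg {n : ℕ} (hn : 3 ≤ n) (μ : Measure (Eucl n)) [IsFiniteMeasure μ] (hμ : μ ≠ 0)
    {p s : ℝ} (hp : p = -((n:ℝ) - 2) / 2) (hs : 0 < s) (x : Eucl n) :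
    ∑ i : Fin n, ∫ w, D2 p s (EuclideanSpace.single i (1:ℝ)) (x - w) ∂μ < 0 := by
  have hn' : (3:ℝ) ≤ n := by exact_mod_cast hn
  have hp0 : p < 0 := by rw [hp]; linarith
  rw [← integral_finsetSum _ fun i _ => D2_int μ hp0.le hs x _ (by simp)]
  have : ∀ w, ∑ i : Fin n, D2 p s (EuclideanSpace.single i (1:ℝ)) (x - w) =
      2 * p * n * s * Kr (p - 2) s (x - w) := fun w => Kr_lap hs (x - w) p hp
  simp_rw [this]
  rw [integral_const_mul]
  have h1 : 0 < ∫ w, Kr (p - 2) s (x - w) ∂μ := by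
    rw [integral_pos_iff_support_of_nonneg (fun w => (Kr_nonneg hs _).le)
      (Kr_int μ (by linarith) hs x)]
    have : Function.support (fun w => Kr (p - 2) s (x - w)) = univ :=
      eq_univ_of_forall fun w => (Kr_nonneg hs _).ne'
    rw [this]
    exact Measure.measure_univ_pos.mpr hμ
  have h2 : 0 < (-p) * n * s := by
    have : 0 < -p := by linarith
    positivity
  nlinarith

lemma no_local_max {n : ℕ} (hn : 3 ≤ n) (μ : Measure (Eucl n)) [IsFiniteMeasure μ] (hμ : μ ≠ 0)
    {p s : ℝ} (hp : p = -((n:ℝ) - 2) / 2) (hs : 0 < s) (x : Eucl n) (G : Set (Eucl n)) (hG : IsOpen G)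
    (hx : x ∈ G) (φ : Eucl n → ℝ) (hφ : IsHarmonicOn φ G)
    (hmax : IsLocalMax (fun y => - Pr μ p s y - φ y) x) : False := by
  have hn' : (3:ℝ) ≤ n := by exact_mod_cast hn
  have hp0 : p ≤ 0 := by rw [hp]; linarith
  have key : ∀ i : Fin n, -(∫ w, D2 p s (EuclideanSpace.single i (1:ℝ)) (x - w) ∂μ) -
      fderiv ℝ (fun y => fderiv ℝ φ y (EuclideanSpace.single i 1)) x
        (EuclideanSpace.single i 1) ≤ 0 := by
    intro i
    set e : Eucl n := EuclideanSpace.single i (1:ℝ) with he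
    have he1 : ‖e‖ = 1 := by simp [he]
    have line : ∀ t : ℝ, HasDerivAt (fun t : ℝ => x + t • e) e t := fun t => by
      simpa using ((hasDerivAt_id t).smul_const e).const_add x
    have hc : Tendsto (fun t : ℝ => x + t • e) (𝓝 0) (𝓝 x) := by
      have := (line 0).continuousAt.tendsto
      simpa using this
    refine second_deriv_nonpos (fun t => - Pr μ p s (x + t • e) - φ (x + t • e))
      (fun t => - (∫ w, D1 p s e (x + t • e - w) ∂μ) - fderiv ℝ φ (x + t • e) e) _ ?_ ?_ ?_
    · filter_upwards [hc.eventually (hG.mem_nhds hx)] with t ht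
      refine (Pr_deriv μ hp0 hs x e he1 t).neg.sub ?_
      have h1 : HasFDerivAt φ (fderiv ℝ φ (x + t • e)) (x + t • e) :=
        ((hφ.1.contDiffAt (hG.mem_nhds ht)).differentiableAt (by norm_num)).hasFDerivAt
      exact h1.comp_hasDerivAt t (line t)
    · have a := Pr_deriv2 μ hp0 hs x e he1 0
      simp only [zero_smul, add_zero] at a
      refine a.neg.sub ?_
      have h1 : DifferentiableAt ℝ (fderiv ℝ φ) x :=
        ((hφ.1.fderiv_of_isOpen (m := 1) hG (by norm_num)).contDiffAt
          (hG.mem_nhds hx)).differentiableAt (by norm_num)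
      have h2 : DifferentiableAt ℝ (fun y => fderiv ℝ φ y e) x := h1.clm_apply (by fun_prop)
      have h3 := h2.hasFDerivAt
      refine HasFDerivAt.comp_hasDerivAt (l := fun y => fderiv ℝ φ y e) (f := fun t : ℝ => x + t • e)
        0 ?_ (line 0)
      simpa using h3
    · have := hc.eventually hmax
      unfold IsLocalMax IsMaxFilter
      simpa using this
  have h1 := Finset.sum_nonpos fun i (_ : i ∈ Finset.univ) => key i
  rw [Finset.sum_sub_distrib, Finset.sum_neg_distrib] at h1
  have h2 := hφ.2 x hx
  unfold lap at h2
  have h3 := sum_D2_neg hn μ hμ hp hs x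
  linarith

lemma max_principle {n : ℕ} (hn : 3 ≤ n) (μ : Measure (Eucl n)) [IsFiniteMeasure μ] (hμ : μ ≠ 0)
    {p s : ℝ} (hp : p = -((n:ℝ) - 2) / 2) (hs : 0 < s) (G : Set (Eucl n)) (hG : IsOpen G)
    (hGc : IsCompact (closure G)) (φ : Eucl n → ℝ) (hφ : IsHarmonicOn φ G)
    (hφc : ContinuousOn φ (closure G)) (δ : ℝ)
    (hb : ∀ x ∈ frontier G, - Pr μ p s x ≤ φ x + δ) : ∀ x ∈ G, - Pr μ p s x ≤ φ x + δ := by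
  intro x hx
  have hn' : (3:ℝ) ≤ n := by exact_mod_cast hn
  have hp0 : p ≤ 0 := by rw [hp]; linarith
  obtain ⟨z, hz, hzm⟩ := hGc.exists_isMaxOn ⟨x, subset_closure hx⟩
    (((Pr_cont μ hp0 hs).neg.continuousOn).sub hφc)
  by_contra hcon
  push Not at hcon
  have h1 : - Pr μ p s x - φ x ≤ - Pr μ p s z - φ z := hzm (subset_closure hx)
  by_cases hzG : z ∈ G
  · refine no_local_max hn μ hμ hp hs z G hG hzG φ hφ ?_
    filter_upwards [hG.mem_nhds hzG] with y hy using hzm (subset_closure hy)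
  · have := hb z (by rw [hG.frontier_eq]; exact ⟨hz, hzG⟩)
    linarith

/-- the sequence of regularization parameters -/
def sk (k : ℕ) : ℝ := 1 / ((k : ℝ) + 1)

lemma sk_pos (k : ℕ) : 0 < sk k := by unfold sk; positivity

lemma sk_anti : Antitone sk := fun a b h => by
  unfold sk
  exact one_div_le_one_div_of_le (by positivity) (by gcongr)

lemma Kr_mono {n : ℕ} {p : ℝ} (hp : p ≤ 0) (y : Eucl n) : Monotone fun k => Kr p (sk k) y := by
  intro a b h
  refine Real.rpow_le_rpow_of_nonpos (q_pos (sk_pos b) y) ?_ hp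
  have := sk_anti h
  linarith

lemma Kr_tendsto {n : ℕ} {p : ℝ} (hn : 3 ≤ n) (hp : p = -((n:ℝ) - 2) / 2) (y : Eucl n) (hy : y ≠ 0) :
    Tendsto (fun k => Kr p (sk k) y) atTop (𝓝 (1 / ‖y‖ ^ (n - 2))) := by
  have hy' : 0 < ‖y‖ := norm_pos_iff.mpr hy
  have h1 : Tendsto (fun k => ‖y‖ ^ 2 + sk k) atTop (𝓝 (‖y‖ ^ 2 + 0)) :=
    tendsto_const_nhds.add tendsto_one_div_add_atTop_nhds_zero_nat
  have h2 := h1.rpow_const (p := p) (Or.inl (by positivity))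
  have h3 : (‖y‖ ^ 2 + 0) ^ p = 1 / ‖y‖ ^ (n - 2) := by
    rw [add_zero, ← Real.rpow_natCast, ← Real.rpow_natCast, ← Real.rpow_mul hy'.le, one_div,
      ← Real.rpow_neg hy'.le, hp]
    congr 1
    rw [Nat.cast_sub (by omega)]
    push_cast
    ring
  rw [h3] at h2
  exact h2

lemma Pr_mono {n : ℕ} (μ : Measure (Eucl n)) [IsFiniteMeasure μ] {p : ℝ} (hp : p ≤ 0) (x : Eucl n) :
    Monotone fun k => Pr μ p (sk k) x := fun a b h =>
  integral_mono (Kr_int μ hp (sk_pos a) x) (Kr_int μ hp (sk_pos b) x) fun w => Kr_mono hp (x - w) h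

lemma pot_tendsto {n : ℕ} (hn : 3 ≤ n) (μ : Measure (Eucl n)) [IsFiniteMeasure μ]
    (hat : ∀ x, μ {x} = 0) {p : ℝ} (hp : p = -((n:ℝ) - 2) / 2) (x : Eucl n) :
    Tendsto (fun k => ((- Pr μ p (sk k) x : ℝ) : EReal)) atTop (𝓝 (potential n μ x)) := by
  have hn' : (3:ℝ) ≤ n := by exact_mod_cast hn
  have hp0 : p ≤ 0 := by rw [hp]; linarith
  have h1 : Tendsto (fun k => ∫⁻ w, ENNReal.ofReal (Kr p (sk k) (x - w)) ∂μ) atTop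
      (𝓝 (∫⁻ w, ENNReal.ofReal (1 / ‖x - w‖ ^ (n - 2)) ∂μ)) := by
    refine lintegral_tendsto_of_tendsto_of_monotone ?_ ?_ ?_
    · exact fun k => (Kr_int μ hp0 (sk_pos k) x).aestronglyMeasurable.aemeasurable.ennreal_ofReal
    · exact Eventually.of_forall fun w a b h => ENNReal.ofReal_le_ofReal (Kr_mono hp0 _ h)
    · have : ∀ᵐ w ∂μ, w ≠ x := by
        rw [ae_iff]
        simpa using hat x
      filter_upwards [this] with w hw
      exact ENNReal.tendsto_ofReal (Kr_tendsto hn hp (x - w) (sub_ne_zero.mpr hw.symm))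
  have h2 : ∀ k, ((- Pr μ p (sk k) x : ℝ) : EReal) =
      -((∫⁻ w, ENNReal.ofReal (Kr p (sk k) (x - w)) ∂μ : ℝ≥0∞) : EReal) := by
    intro k
    rw [← ofReal_integral_eq_lintegral_ofReal (Kr_int μ hp0 (sk_pos k) x)
      (Eventually.of_forall fun w => (Kr_nonneg (sk_pos k) _).le)]
    rw [EReal.coe_ennreal_ofReal, max_eq_left, EReal.coe_neg]
    · rfl
    · exact integral_nonneg fun w => (Kr_nonneg (sk_pos k) _).le
  simp_rw [h2]
  exact (continuous_neg.tendsto _).comp ((continuous_coe_ennreal_ereal.tendsto _).comp h1)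

lemma pot_le {n : ℕ} (hn : 3 ≤ n) (μ : Measure (Eucl n)) [IsFiniteMeasure μ]
    (hat : ∀ x, μ {x} = 0) {p : ℝ} (hp : p = -((n:ℝ) - 2) / 2) (x : Eucl n) (k : ℕ) :
    potential n μ x ≤ ((- Pr μ p (sk k) x : ℝ) : EReal) := by
  have hn' : (3:ℝ) ≤ n := by exact_mod_cast hn
  have hp0 : p ≤ 0 := by rw [hp]; linarith
  refine Antitone.le_of_tendsto (f := fun k => ((- Pr μ p (sk k) x : ℝ) : EReal)) ?_
    (pot_tendsto hn μ hat hp x) k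
  intro a b h
  exact EReal.coe_le_coe_iff.mpr (neg_le_neg (Pr_mono μ hp0 x h))

lemma pot_subharmonic {n : ℕ} (hn : 3 ≤ n) (μ : Measure (Eucl n)) [IsFiniteMeasure μ] (hμ : μ ≠ 0)
    (hat : ∀ x, μ {x} = 0) (hf : ∃ x, potential n μ x ≠ ⊥) :
    IsSubharmonicOn (potential n μ) univ := by
  obtain ⟨p, hp⟩ : ∃ p : ℝ, p = -((n:ℝ) - 2) / 2 := ⟨_, rfl⟩
  have hn' : (3:ℝ) ≤ n := by exact_mod_cast hn
  have hp0 : p ≤ 0 := by rw [hp]; linarith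
  refine ⟨?_, ?_, ?_, ?_⟩
  · intro x _ y hy
    obtain ⟨k, hk⟩ := ((pot_tendsto hn μ hat hp x).eventually (gt_mem_nhds hy)).exists
    rw [nhdsWithin_univ]
    have hc : Continuous fun x => ((- Pr μ p (sk k) x : ℝ) : EReal) :=
      continuous_coe_real_ereal.comp (Pr_cont μ hp0 (sk_pos k)).neg
    filter_upwards [hc.continuousAt.eventually (gt_mem_nhds hk)] with z hz
    exact (pot_le hn μ hat hp z k).trans_lt hz
  · intro x _
    exact (pot_le hn μ hat hp x 0).trans_lt (EReal.coe_lt_top _)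
  · obtain ⟨x, hx⟩ := hf
    exact ⟨x, mem_univ _, hx⟩
  · intro G hG hGc _ φ hφ hφc hb x hx
    have main : ∀ δ : ℝ, 0 < δ → potential n μ x ≤ ((φ x + δ : ℝ) : EReal) := by
      intro δ hδ
      have hFc : IsCompact (frontier G) := hGc.of_isClosed_subset isClosed_frontier frontier_subset_closure
      have : CompactSpace (frontier G) := isCompact_iff_compactSpace.mp hFc
      have hφF : Continuous fun z : frontier G => φ z :=
        continuousOn_iff_continuous_domRestrict.mp (hφc.mono frontier_subset_closure)
      have hop : ∀ k, IsOpen {z : frontier G | - Pr μ p (sk k) z < φ z + δ} := fun k =>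
        isOpen_lt ((Pr_cont μ hp0 (sk_pos k)).neg.comp continuous_subtype_val)
          (hφF.add continuous_const)
      have hcov : (univ : Set (frontier G)) ⊆
          ⋃ k, {z : frontier G | - Pr μ p (sk k) z < φ z + δ} := by
        rintro ⟨z, hz⟩ -
        have h1 : potential n μ z < ((φ z + δ : ℝ) : EReal) :=
          (hb z hz).trans_lt (EReal.coe_lt_coe_iff.mpr (by linarith))
        obtain ⟨k, hk⟩ := ((pot_tendsto hn μ hat hp z).eventually (gt_mem_nhds h1)).exists
        exact mem_iUnion.mpr ⟨k, EReal.coe_lt_coe_iff.mp hk⟩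
      have hdir : Directed (fun x1 x2 => x1 ⊆ x2)
          (fun k => {z : frontier G | - Pr μ p (sk k) z < φ z + δ}) := by
        refine directed_of_isDirected_le ?_
        intro a b h z hz
        exact (neg_le_neg (Pr_mono μ hp0 z.1 h)).trans_lt hz
      obtain ⟨k, hk⟩ := isCompact_univ.elim_directed_cover _ hop hcov hdir
      have hk' : ∀ z ∈ frontier G, - Pr μ p (sk k) z ≤ φ z + δ := by
        intro z hz
        have h1 : (⟨z, hz⟩ : frontier G) ∈ {z : frontier G | - Pr μ p (sk k) z < φ z + δ} :=
          hk (mem_univ _)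
        rw [mem_setOf_eq] at h1
        exact h1.le
      have h2 := max_principle hn μ hμ hp (sk_pos k) G hG hGc φ hφ hφc δ hk' x hx
      exact (pot_le hn μ hat hp x k).trans (EReal.coe_le_coe_iff.mpr h2)
    refine le_of_forall_gt fun c hc => ?_
    obtain ⟨r, hr1, hr2⟩ := EReal.lt_iff_exists_real_btwn.mp hc
    have hr3 := EReal.coe_lt_coe_iff.mp hr1
    have := main (r - φ x) (by linarith)
    rw [add_sub_cancel] at this
    exact this.trans_lt hr2

lemma incl_norm_sub {m : ℕ} (x y : Eucl (m + 2 - 2)) : ‖incl (m + 2) x - incl (m + 2) y‖ = ‖x - y‖ := by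
  rw [← sq_eq_sq₀ (norm_nonneg _) (norm_nonneg _), EuclideanSpace.norm_sq_eq,
    EuclideanSpace.norm_sq_eq, Fin.sum_univ_castSucc, Fin.sum_univ_castSucc]
  simp [incl]
  rfl

lemma incl_cont (n : ℕ) : Continuous (incl n) := by
  unfold incl
  refine (EuclideanSpace.equiv (Fin n) ℝ).symm.continuous.comp (continuous_pi fun i => ?_)
  by_cases h : (i : ℕ) < n - 2
  · simp only [h, dite_true]; fun_prop
  · simp only [h, dite_false]; fun_prop

lemma pot_incl {m : ℕ} (i : ℕ) (a : Eucl (m + 2 - 2)) :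
    potential (m + 2) (annulusMeasure (m + 2) i) (incl (m + 2) a) =
    - ((∫⁻ w in (Metric.ball (0 : Eucl (m + 2 - 2)) (i : ℝ) \ Metric.ball 0 (1 / (i : ℝ))),
      ENNReal.ofReal (1 / ‖a - w‖ ^ m) : ℝ≥0∞) : EReal) := by
  unfold potential annulusMeasure
  rw [lintegral_map (by fun_prop) (incl_cont _).measurable]
  simp_rw [incl_norm_sub]
  rfl

lemma div_lemma {m : ℕ} (hm : 1 ≤ m) (i : ℕ) (hi : 2 ≤ i) (a : Eucl m)
    (ha : a ∈ Metric.ball (0 : Eucl m) (i : ℝ) \ Metric.ball 0 (1 / (i : ℝ))) :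
    ∫⁻ w in (Metric.ball (0 : Eucl m) (i : ℝ) \ Metric.ball 0 (1 / (i : ℝ))),
      ENNReal.ofReal (1 / ‖a - w‖ ^ m) = ⊤ := by
  have : Nonempty (Fin m) := ⟨⟨0, hm⟩⟩
  have hi' : (0:ℝ) < i := by positivity
  set A := Metric.ball (0 : Eucl m) (i : ℝ) \ Metric.ball 0 (1 / (i : ℝ)) with hA
  obtain ⟨ha1, ha2⟩ := ha
  simp only [mem_ball_zero_iff, not_lt] at ha1 ha2
  have ha0 : 0 < ‖a‖ := lt_of_lt_of_le (by positivity) ha2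
  set c := (volume : Measure (Eucl m)) (ball 0 1) with hc
  have hc0 : c ≠ 0 := (measure_ball_pos _ _ one_pos).ne'
  have hct : c ≠ ⊤ := measure_ball_lt_top.ne
  by_contra hfin
  obtain ⟨δ, hδ, H⟩ := exists_pos_setLIntegral_lt_of_measure_lt hfin
    (ε := ENNReal.ofReal ((1/2) ^ m) * c)
    (mul_ne_zero (by simp) hc0)
  have hlim : Tendsto (fun r : ℝ => ENNReal.ofReal (r ^ m) * c) (𝓝[>] 0) (𝓝 0) := by
    have h1 : Tendsto (fun r : ℝ => ENNReal.ofReal (r ^ m) * c) (𝓝 0)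
        (𝓝 (ENNReal.ofReal ((0:ℝ) ^ m) * c)) := by
      refine ENNReal.Tendsto.mul_const ?_ (Or.inr hct)
      exact ENNReal.tendsto_ofReal ((continuous_pow m).tendsto 0)
    rw [zero_pow (by omega), ENNReal.ofReal_zero, zero_mul] at h1
    exact h1.mono_left nhdsWithin_le_nhds
  obtain ⟨r, ⟨hr1, hr2⟩, hr0⟩ := ((hlim.eventually (gt_mem_nhds hδ)).and
    ((eventually_lt_nhds (a := (0:ℝ)) (b := (i - ‖a‖) / 2) (by linarith)).filter_mono
      nhdsWithin_le_nhds)).and self_mem_nhdsWithin |>.exists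
  replace hr0 : 0 < r := hr0
  set e : Eucl m := a + (r / ‖a‖) • a with he
  have hev : ∀ w ∈ ball e r, w ∈ A ∧ 0 < ‖a - w‖ ∧ ‖a - w‖ ≤ 2 * r := by
    intro w hw
    rw [mem_ball_iff_norm] at hw
    have n1 : ‖(r / ‖a‖) • a‖ = r := by
      rw [norm_smul, Real.norm_eq_abs, abs_of_pos (by positivity)]; field_simp
    have n2 : ‖e‖ = ‖a‖ + r := by
      rw [he, show a + (r / ‖a‖) • a = (1 + r / ‖a‖) • a by rw [add_smul, one_smul], norm_smul,
        Real.norm_eq_abs, abs_of_pos (by positivity)]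
      field_simp
    have t1 : ‖w‖ ≤ ‖w - e‖ + ‖e‖ := by simpa using norm_add_le (w - e) e
    have t2 : ‖e‖ ≤ ‖w - e‖ + ‖w‖ := by
      have := norm_sub_le w (w - e)
      rw [_root_.sub_sub_cancel] at this
      linarith
    have t3 : ‖a - w‖ ≤ ‖w - e‖ + r := by
      have := norm_add_le (w - e) ((r / ‖a‖) • a)
      rw [n1] at this
      rw [norm_sub_rev]
      convert this using 2
      rw [he]; abel
    refine ⟨⟨?_, ?_⟩, ?_, ?_⟩
    · rw [mem_ball_zero_iff]; linarith
    · rw [mem_ball_zero_iff]; linarith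
    · rw [norm_pos_iff, sub_ne_zero]
      rintro rfl
      linarith
    · linarith
  have hvol : (volume : Measure (Eucl m)) (ball e r) = ENNReal.ofReal (r ^ m) * c := by
    rw [Measure.addHaar_ball _ _ hr0.le, finrank_euclideanSpace_fin]
  have hsub : ball e r ⊆ A := fun w hw => (hev w hw).1
  have H1 := H (ball e r) ((Measure.restrict_apply_le _ _).trans_lt (by rw [hvol]; exact hr1))
  rw [Measure.restrict_restrict measurableSet_ball, inter_eq_self_of_subset_left hsub] at H1
  refine absurd H1 (not_lt.mpr ?_)
  calc ENNReal.ofReal ((1/2) ^ m) * c = ENNReal.ofReal (1 / (2 * r) ^ m) * volume (ball e r) := by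
        rw [hvol, ← mul_assoc, ← ENNReal.ofReal_mul (by positivity)]
        congr 2
        rw [mul_pow, div_pow]
        field_simp
        try simp
    _ = ∫⁻ w in ball e r, ENNReal.ofReal (1 / (2 * r) ^ m) := by simp
    _ ≤ _ := by
        refine setLIntegral_mono' measurableSet_ball fun w hw => ?_
        obtain ⟨-, h2, h3⟩ := hev w hw
        refine ENNReal.ofReal_le_ofReal ?_
        gcongr

lemma zero_lemma {m : ℕ} (hm : 1 ≤ m) (i : ℕ) (hi : 2 ≤ i) :
    (∫⁻ w in (Metric.ball (0 : Eucl m) (i : ℝ) \ Metric.ball 0 (1 / (i : ℝ))),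
      ENNReal.ofReal (1 / ‖0 - w‖ ^ m) < ⊤) ∧
    0 < ∫⁻ w in (Metric.ball (0 : Eucl m) (i : ℝ) \ Metric.ball 0 (1 / (i : ℝ))),
      ENNReal.ofReal (1 / ‖0 - w‖ ^ m) := by
  have hi' : (2:ℝ) ≤ i := by exact_mod_cast hi
  have hi0 : (0:ℝ) < i := by linarith
  constructor
  · refine setLIntegral_lt_top_of_le_nnreal 
      ((measure_mono sdiff_subset).trans_lt measure_ball_lt_top).ne
      ⟨Real.toNNReal (1 / (1 / (i:ℝ)) ^ m), fun w hw => ?_⟩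
    have h2 := hw.2
    simp only [mem_ball_zero_iff, not_lt] at h2
    have h3 : 0 < 1 / (i:ℝ) := by positivity
    rw [zero_sub, norm_neg]
    refine ENNReal.ofReal_le_ofReal ?_
    gcongr
  · rw [setLIntegral_pos_iff (by fun_prop)]
    have hopen : IsOpen (Metric.ball (0 : Eucl m) (i : ℝ) \ Metric.closedBall 0 (1 / (i : ℝ))) :=
      isOpen_ball.sdiff isClosed_closedBall
    have hne : (Metric.ball (0 : Eucl m) (i : ℝ) \ Metric.closedBall 0 (1 / (i : ℝ))).Nonempty := by
      refine ⟨EuclideanSpace.single ⟨0, hm⟩ (1:ℝ), ?_, ?_⟩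
      · simp; omega
      · have : 1 / (i:ℝ) < 1 := by rw [div_lt_one hi0]; linarith
        simp only [mem_closedBall_zero_iff, EuclideanSpace.norm_single, norm_one, not_le]
        exact this
    refine (hopen.measure_pos volume hne).trans_le (measure_mono ?_)
    rintro w ⟨h1, h2⟩
    simp only [mem_closedBall_zero_iff, not_le] at h2
    refine ⟨?_, h1, ?_⟩
    · have : 0 < ‖w‖ := lt_trans (by positivity) h2
      simp only [Function.mem_support, zero_sub, norm_neg]
      refine (ENNReal.ofReal_pos.mpr (by positivity)).ne'
    · simp only [mem_ball_zero_iff, not_lt]; exact h2.le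

/-- For `n ≥ 3` and an integer `i ≥ 2`, the potential `p_{μᵢ}` of the annulus measure
`μᵢ` is subharmonic on `ℝⁿ`, nonpositive, identically `-∞` on the annulus
`(B_{n-2}(0,i) \ B_{n-2}(0,1/i)) × {0} × {0}`, and satisfies `-∞ < p_{μᵢ}(0) < 0`. -/
theorem annulus_potential_properties {n : ℕ} (hn : 3 ≤ n) (i : ℕ) (hi : 2 ≤ i) :
    IsSubharmonicOn (potential n (annulusMeasure n i)) Set.univ ∧
      (∀ x : Eucl n, potential n (annulusMeasure n i) x ≤ 0) ∧
      (∀ x ∈ (incl n) '' (Metric.ball (0 : Eucl (n - 2)) (i : ℝ) \ Metric.ball 0 (1 / (i : ℝ))),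
        potential n (annulusMeasure n i) x = ⊥) ∧
      ⊥ < potential n (annulusMeasure n i) 0 ∧
      potential n (annulusMeasure n i) 0 < 0 := by
  obtain ⟨m, rfl⟩ : ∃ m, n = m + 2 := ⟨n - 2, by omega⟩
  have hm : 1 ≤ m := by omega
  have hz : incl (m + 2) 0 = 0 := by
    ext j
    simp [incl]
  have hp0 := pot_incl (m := m) i 0
  rw [hz] at hp0
  obtain ⟨z1, z2⟩ := zero_lemma hm i hi
  have hb : ⊥ < potential (m + 2) (annulusMeasure (m + 2) i) 0 := by
    rw [hp0, bot_lt_iff_ne_bot, ne_eq, EReal.neg_eq_bot_iff, EReal.coe_ennreal_eq_top_iff]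
    exact z1.ne
  have hneg : potential (m + 2) (annulusMeasure (m + 2) i) 0 < 0 := by
    rw [hp0, ← EReal.neg_lt_neg_iff, neg_neg, neg_zero]
    exact EReal.coe_ennreal_pos.mpr z2
  have hfin : IsFiniteMeasure (annulusMeasure (m + 2) i) := by
    have : IsFiniteMeasure ((volume : Measure (Eucl (m + 2 - 2))).restrict
      (Metric.ball (0 : Eucl (m + 2 - 2)) (i : ℝ) \ Metric.ball 0 (1 / (i : ℝ)))) :=
      isFiniteMeasure_restrict.mpr ((measure_mono sdiff_subset).trans_lt measure_ball_lt_top).ne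
    unfold annulusMeasure
    infer_instance
  have hat : ∀ x, annulusMeasure (m + 2) i {x} = 0 := by
    intro x
    unfold annulusMeasure
    rw [Measure.map_apply (incl_cont _).measurable (measurableSet_singleton x)]
    have : Nonempty (Fin (m + 2 - 2)) := ⟨⟨0, hm⟩⟩
    refine Set.Subsingleton.measure_zero ?_ _
    intro a ha b hb
    have h1 := incl_norm_sub (m := m) a b
    rw [mem_preimage, mem_singleton_iff] at ha hb
    rw [ha, hb, sub_self, norm_zero] at h1
    exact sub_eq_zero.mp (norm_eq_zero.mp h1.symm)
  have hμ : annulusMeasure (m + 2) i ≠ 0 := by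
    intro h
    rw [h] at hneg
    simp [potential] at hneg
  refine ⟨pot_subharmonic hn _ hμ hat ⟨0, hb.ne'⟩, ?_, ?_, hb, hneg⟩
  · intro x
    unfold potential
    rw [EReal.neg_le, neg_zero]
    exact EReal.coe_ennreal_nonneg _
  · rintro _ ⟨a, ha, rfl⟩
    have h1 := div_lemma hm i hi a ha
    rw [pot_incl, EReal.neg_eq_bot_iff, EReal.coe_ennreal_eq_top_iff]
    exact h1

end
end
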